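/- arXiv:1811.08142 — 2 statements merged into one kernel-verified Lean document; each statement's English description precedes it below -/
import Mathlib

section
/- Every nondegenerate *-representation σ of ℝ(X)^Γ on a Hilbert space H₀ extends in a unique way to a *-representation σ̂ of 𝕊(X)^Γ on H₀, i.e. there is exactly one *-homomorphism σ̂ : 𝕊(X)^Γ → B(H₀) with σ̂(T) = σ(T) for all T ∈ ℝ(X)^Γ. -/
open scoped ZeroAtInfty
open Metric Filter

noncomputable section

variable {X : Type*} [MetricSpace X] {Γ : Type*} [Group Γ] [MulAction Γ X]
variable {H : Type*} [NormedAddCommGroup H] [InnerProductSpace ℂ H] [CompleteSpace H]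

/-- `T` has propagation at most `r` with respect to the representation `ρ` of `C₀(X)`. -/
def HasPropLE (ρ : C₀(X, ℂ) →⋆ₙₐ[ℂ] (H →L[ℂ] H)) (T : H →L[ℂ] H) (r : ℝ) : Prop :=
  ∀ f g : C₀(X, ℂ),
    (∀ x ∈ tsupport ⇑f, ∀ y ∈ tsupport ⇑g, r ≤ dist x y) → ρ f * T * ρ g = 0

/-- `T` is locally compact with respect to `ρ`. -/
def IsLocCompactOp (ρ : C₀(X, ℂ) →⋆ₙₐ[ℂ] (H →L[ℂ] H)) (T : H →L[ℂ] H) : Prop :=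
  ∀ f : C₀(X, ℂ), IsCompactOperator ⇑(ρ f * T) ∧ IsCompactOperator ⇑(T * ρ f)

/-- `T` is pseudolocal with respect to `ρ`. -/
def IsPseudolocalOp (ρ : C₀(X, ℂ) →⋆ₙₐ[ℂ] (H →L[ℂ] H)) (T : H →L[ℂ] H) : Prop :=
  ∀ f : C₀(X, ℂ), IsCompactOperator ⇑(ρ f * T - T * ρ f)

/-- `T` is invariant under the unitary representation `u` of `Γ`. -/
def IsEquivariantOp (u : Γ →* unitary (H →L[ℂ] H)) (T : H →L[ℂ] H) : Prop :=
  ∀ γ : Γ, (u γ : H →L[ℂ] H) * T = T * (u γ : H →L[ℂ] H)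

/-- `ρ` is covariant for the unitary representation `u`. -/
def CovariantRep (ρ : C₀(X, ℂ) →⋆ₙₐ[ℂ] (H →L[ℂ] H)) (u : Γ →* unitary (H →L[ℂ] H)) : Prop :=
  ∀ (γ : Γ) (f g : C₀(X, ℂ)), (∀ x : X, g x = f (γ⁻¹ • x)) →
    (ρ g : H →L[ℂ] H) = (u γ : H →L[ℂ] H) * ρ f * star ((u γ : H →L[ℂ] H))

/-- `ρ` is ample: only `0` acts as a compact operator. -/
def AmpleRep (ρ : C₀(X, ℂ) →⋆ₙₐ[ℂ] (H →L[ℂ] H)) : Prop :=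
  ∀ f : C₀(X, ℂ), IsCompactOperator ⇑(ρ f) → f = 0

/-- `ρ` is nondegenerate. -/
def NondegRep (ρ : C₀(X, ℂ) →⋆ₙₐ[ℂ] (H →L[ℂ] H)) : Prop :=
  Dense (Submodule.span ℂ {w : H | ∃ (f : C₀(X, ℂ)) (v : H), ρ f v = w} : Set H)

/-- The algebraic equivariant Roe algebra `ℝ(X)^Γ`: Γ-invariant, locally compact,
finite propagation operators. -/
def RoeAlgSet (ρ : C₀(X, ℂ) →⋆ₙₐ[ℂ] (H →L[ℂ] H)) (u : Γ →* unitary (H →L[ℂ] H)) :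
    Set (H →L[ℂ] H) :=
  {T | IsEquivariantOp u T ∧ IsLocCompactOp ρ T ∧ ∃ r : ℝ, 0 ≤ r ∧ HasPropLE ρ T r}

/-- The algebraic equivariant structure algebra `𝕊(X)^Γ`: Γ-invariant, pseudolocal,
finite propagation operators. -/
def StructAlgSet (ρ : C₀(X, ℂ) →⋆ₙₐ[ℂ] (H →L[ℂ] H)) (u : Γ →* unitary (H →L[ℂ] H)) :
    Set (H →L[ℂ] H) :=
  {T | IsEquivariantOp u T ∧ IsPseudolocalOp ρ T ∧ ∃ r : ℝ, 0 ≤ r ∧ HasPropLE ρ T r}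

/-- `σ` is a `*`-representation of the `*`-algebra given by the subset `R ⊆ B(H)`. -/
def IsStarRepOn {H' : Type*} [NormedAddCommGroup H'] [InnerProductSpace ℂ H']
    [CompleteSpace H'] (R : Set (H →L[ℂ] H)) (σ : (H →L[ℂ] H) → (H' →L[ℂ] H')) : Prop :=
  (∀ T ∈ R, ∀ S ∈ R, σ (T + S) = σ T + σ S) ∧
  (∀ (c : ℂ), ∀ T ∈ R, σ (c • T) = c • σ T) ∧
  (∀ T ∈ R, ∀ S ∈ R, σ (T * S) = σ T * σ S) ∧
  (∀ T ∈ R, σ (star T) = star (σ T))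

/-- `σ` is a nondegenerate representation of the set `R ⊆ B(H)` on `H'`. -/
def IsNondegRepOn {H' : Type*} [NormedAddCommGroup H'] [InnerProductSpace ℂ H']
    [CompleteSpace H'] (R : Set (H →L[ℂ] H)) (σ : (H →L[ℂ] H) → (H' →L[ℂ] H')) : Prop :=
  Dense (Submodule.span ℂ {w : H' | ∃ T ∈ R, ∃ v : H', σ T v = w} : Set H')

/-- `X` has bounded geometry. -/
def BoundedGeometry (X : Type*) [MetricSpace X] : Prop :=
  ∃ (Y : Set X) (c : ℝ), 0 < c ∧ (∀ x : X, ∃ y ∈ Y, dist x y < c) ∧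
    ∀ r : ℝ, 0 < r → ∃ N : ℕ, ∀ x : X,
      (Y ∩ Metric.ball x r).Finite ∧ (Y ∩ Metric.ball x r).ncard ≤ N

set_option linter.unusedSectionVars false

/-! ### Operators on Hilbert spaces -/

/-- The adjoint of a compact operator between Hilbert spaces is compact. -/
theorem IsCompactOperator.star_clm {T : H →L[ℂ] H} (hT : IsCompactOperator T) :
    IsCompactOperator ⇑(star T) := by
  set A : H →L[ℂ] H := star T with hA
  have hS : IsCompactOperator (T * A) := hT.comp_clm A
  have key (x y : H) : ‖A x - A y‖ ^ 2 ≤ ‖T (A x) - T (A y)‖ * ‖x - y‖ := by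
    have h1 : ‖A x - A y‖ ^ 2 = RCLike.re (inner ℂ (T (A x) - T (A y)) (x - y)) := by
      rw [← map_sub, ← map_sub, hA, ContinuousLinearMap.star_eq_adjoint,
        ← ContinuousLinearMap.adjoint_inner_right, map_sub, inner_self_eq_norm_sq]
    rw [h1]
    exact re_inner_le_norm _ _
  refine (isCompactOperator_iff_isCompact_closure_image_closedBall A.toLinearMap one_pos).2 ?_
  refine TotallyBounded.isCompact_of_isClosed ?_ isClosed_closure
  refine TotallyBounded.closure ?_
  have hK := (hS.isCompact_closure_image_closedBall (f := (T * A).toLinearMap) 1).totallyBounded.subset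
    subset_closure
  rw [Metric.totallyBounded_iff]
  intro ε hε
  obtain ⟨t, hts, htf, htc⟩ := Metric.finite_approx_of_totallyBounded hK (ε ^ 2 / 2) (by positivity)
  have hts' : ∀ y ∈ t, ∃ x ∈ closedBall (0 : H) 1, (T * A).toLinearMap x = y := fun y hy => hts hy
  choose! g hg using hts'
  refine ⟨(fun y => A (g y)) '' t, htf.image _, ?_⟩
  rintro _ ⟨x, hx, rfl⟩
  have hx' := htc (Set.mem_image_of_mem (T * A).toLinearMap hx)
  simp only [Set.mem_iUnion] at hx' ⊢
  obtain ⟨y, hy, hxy⟩ := hx'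
  refine ⟨A (g y), Set.mem_image_of_mem _ hy, ?_⟩
  obtain ⟨hg1, hg2⟩ := hg y hy
  rw [mem_ball, dist_eq_norm] at hxy ⊢
  have h2 := key x (g y)
  have h3 : ‖x - g y‖ ≤ 2 := by
    have := norm_sub_le x (g y)
    rw [mem_closedBall_zero_iff] at hx hg1
    linarith
  rw [← hg2] at hxy
  have h4 : ‖T (A x) - T (A (g y))‖ < ε ^ 2 / 2 := hxy
  have h5 : ‖A x - A (g y)‖ ^ 2 < ε ^ 2 := by
    nlinarith [norm_nonneg (x - g y), norm_nonneg (T (A x) - T (A (g y)))]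
  exact lt_of_pow_lt_pow_left₀ 2 hε.le h5

/-- An orthonormal family in a separable Hilbert space is countable. -/
theorem Orthonormal.countable_of_separable [TopologicalSpace.SeparableSpace H] {ι : Type*}
    {v : ι → H} (hv : Orthonormal ℂ v) : Countable ι := by
  refine Pairwise.countable_of_isOpen_disjoint (s := fun i => ball (v i) (1 / 2)) ?_
    (fun _ => isOpen_ball) (fun i => ⟨v i, mem_ball_self (by norm_num)⟩)
  intro i j hij
  refine ball_disjoint_ball ?_
  have h : ‖v i - v j‖ ^ 2 = 2 := by
    rw [@norm_sub_sq ℂ, hv.1 i, hv.1 j, hv.2 hij]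
    norm_num
  rw [dist_eq_norm]
  nlinarith [norm_nonneg (v i - v j)]

/-- A separable Hilbert space embeds isometrically into every infinite-dimensional Hilbert space. -/
theorem exists_linearIsometry_of_not_finiteDimensional [TopologicalSpace.SeparableSpace H]
    {K : Type*} [NormedAddCommGroup K] [InnerProductSpace ℂ K] [CompleteSpace K]
    (hK : ¬ FiniteDimensional ℂ K) : Nonempty (H →ₗᵢ[ℂ] K) := by
  obtain ⟨w, b, -⟩ := exists_hilbertBasis ℂ H
  obtain ⟨w', b', -⟩ := exists_hilbertBasis ℂ K
  have : Countable w := b.orthonormal.countable_of_separable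
  have : Infinite w' := by
    by_contra h
    rw [not_infinite_iff_finite] at h
    have := Fintype.ofFinite w'
    exact hK b'.toOrthonormalBasis.toBasis.finiteDimensional_of_finite
  obtain ⟨f, hf⟩ := exists_injective_nat w
  let e : w → w' := fun i => Infinite.natEmbedding w' (f i)
  have he : Function.Injective e := (Infinite.natEmbedding w').injective.comp hf
  have ho := b'.orthonormal.comp e he
  exact ⟨ho.orthogonalFamily.linearIsometry.comp b.repr.toLinearIsometry⟩

/-- A family of operators which is square summable, with sum the quadratic form of `Q`, on a dense
set is so everywhere. -/
theorem hasSum_norm_sq_of_dense {ι : Type*} (A : ι → H →L[ℂ] H) (Q : ℝ) {D : Set H}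
    (hD : Dense D) (h : ∀ v ∈ D, HasSum (fun i => ‖A i v‖ ^ 2) (Q * ‖v‖ ^ 2)) (v : H) :
    HasSum (fun i => ‖A i v‖ ^ 2) (Q * ‖v‖ ^ 2) := by
  have hle (s : Finset ι) (v : H) : ∑ i ∈ s, ‖A i v‖ ^ 2 ≤ Q * ‖v‖ ^ 2 := by
    have hcl : IsClosed {v : H | ∑ i ∈ s, ‖A i v‖ ^ 2 ≤ Q * ‖v‖ ^ 2} :=
      isClosed_le (by fun_prop) (by fun_prop)
    exact hcl.closure_subset_iff.2
      (fun w hw => sum_le_hasSum s (fun _ _ => by positivity) (h w hw)) (hD v)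
  rcases subsingleton_or_nontrivial H with hs | hn
  · have : v = 0 := Subsingleton.elim _ _
    subst this
    simp
  have hQ : 0 ≤ Q := by
    obtain ⟨x, hx⟩ := exists_ne (0 : H)
    have h1 := hle ∅ x
    have h2 : 0 < ‖x‖ ^ 2 := by positivity
    simp only [Finset.sum_empty] at h1
    exact nonneg_of_mul_nonneg_left h1 h2
  have hsum (v : H) : Summable fun i => ‖A i v‖ ^ 2 :=
    summable_of_sum_le (fun _ => by positivity) (hle · v)
  have hmem (v : H) : Memℓp (fun i => A i v) 2 := by
    refine memℓp_gen ?_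
    simpa using hsum v
  let L : H →ₗ[ℂ] lp (fun _ : ι => H) 2 :=
    { toFun := fun v => ⟨fun i => A i v, hmem v⟩
      map_add' := fun x y => by ext i; exact map_add (A i) x y
      map_smul' := fun c x => by ext i; simp }
  have hL (v : H) : ‖L v‖ ^ 2 = ∑' i, ‖A i v‖ ^ 2 := by
    have := lp.norm_rpow_eq_tsum (p := 2) (by norm_num) (L v)
    simpa [L] using this
  let L' : H →L[ℂ] lp (fun _ : ι => H) 2 := L.mkContinuous (Real.sqrt Q) fun v => by
    refine le_of_sq_le_sq ?_ (by positivity)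
    rw [mul_pow, Real.sq_sqrt hQ, hL]
    exact (hsum v).tsum_le_of_sum_le (hle · v)
  have heq : {v : H | ‖L' v‖ ^ 2 = Q * ‖v‖ ^ 2} = Set.univ := by
    have hcl : IsClosed {v : H | ‖L' v‖ ^ 2 = Q * ‖v‖ ^ 2} :=
      isClosed_eq (by fun_prop) (by fun_prop)
    rw [← hcl.closure_eq, ← Set.univ_subset_iff, ← hD.closure_eq]
    exact closure_mono fun w hw => (hL w).trans (h w hw).tsum_eq
  have hv : ‖L' v‖ ^ 2 = Q * ‖v‖ ^ 2 := by
    have : v ∈ {v : H | ‖L' v‖ ^ 2 = Q * ‖v‖ ^ 2} := heq ▸ Set.mem_univ v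
    exact this
  rw [← hv]
  exact (hL v) ▸ (hsum v).hasSum

/-- Assembling a square summable family of operators along an orthogonal family of isometries. -/
theorem exists_clm_hasSum_of_orthogonalFamily {ι : Type*} {J : ι → H →ₗᵢ[ℂ] H}
    (hJ : OrthogonalFamily ℂ (fun _ => H) J) (A : ι → H →L[ℂ] H) (q : H → ℝ) (C : ℝ)
    (hq : ∀ v, q v ≤ C * ‖v‖ ^ 2) (h : ∀ v, HasSum (fun i => ‖A i v‖ ^ 2) (q v)) :
    ∃ B : H →L[ℂ] H, (∀ v, HasSum (fun i => J i (A i v)) (B v)) ∧ ∀ v, ‖B v‖ ^ 2 = q v := by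
  have hmem (v : H) : Memℓp (fun i => A i v) 2 := by
    refine memℓp_gen ?_
    simpa using (h v).summable
  let L : H →ₗ[ℂ] lp (fun _ : ι => H) 2 :=
    { toFun := fun v => ⟨fun i => A i v, hmem v⟩
      map_add' := fun x y => by ext i; exact map_add (A i) x y
      map_smul' := fun c x => by ext i; simp }
  have hL (v : H) : ‖L v‖ ^ 2 = q v := by
    have := lp.norm_rpow_eq_tsum (p := 2) (by norm_num) (L v)
    rw [← (h v).tsum_eq]
    simpa [L] using this
  let L' : H →L[ℂ] lp (fun _ : ι => H) 2 := L.mkContinuous (Real.sqrt (max C 0)) fun v => by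
    refine le_of_sq_le_sq ?_ (by positivity)
    rw [mul_pow, Real.sq_sqrt (le_max_right _ _), hL]
    exact (hq v).trans (by gcongr; exact le_max_left _ _)
  refine ⟨hJ.linearIsometry.toContinuousLinearMap.comp L', fun v => ?_, fun v => ?_⟩
  · exact hJ.hasSum_linearIsometry (L v)
  · rw [← hL v]
    exact congrArg (· ^ 2) (hJ.linearIsometry.norm_map (L v))

/-! ### Representations of `C₀(X)` on a proper metric space -/

/-- The piecewise linear function which is `1` on `(-∞, R]` and `0` on `[R + 1, ∞)`. -/
def ramp (R t : ℝ) : ℝ := max 0 (min 1 (R + 1 - t))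

theorem continuous_ramp (R : ℝ) : Continuous (ramp R) := by unfold ramp; fun_prop

theorem ramp_nonneg (R t : ℝ) : 0 ≤ ramp R t := le_max_left _ _

theorem ramp_le_one (R t : ℝ) : ramp R t ≤ 1 := max_le zero_le_one (min_le_left _ _)

theorem ramp_eq_one {R t : ℝ} (h : t ≤ R) : ramp R t = 1 := by
  unfold ramp
  rw [min_eq_left (by linarith), max_eq_right zero_le_one]

theorem ramp_eq_zero {R t : ℝ} (h : R + 1 ≤ t) : ramp R t = 0 := by
  unfold ramp
  exact max_eq_left ((min_le_right _ _).trans (by linarith))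

/-- A compactly supported continuous real function as an element of `C₀(X, ℂ)`. -/
def ofRealC0 (f : X → ℝ) (hf : Continuous f) (hc : HasCompactSupport f) : C₀(X, ℂ) where
  toFun x := (f x : ℂ)
  continuous_toFun := Complex.continuous_ofReal.comp hf
  zero_at_infty' := (hc.comp_left (g := Complex.ofReal) (by simp)).is_zero_at_infty

@[simp]
theorem ofRealC0_apply (f : X → ℝ) (hf : Continuous f) (hc : HasCompactSupport f) (x : X) :
    ofRealC0 f hf hc x = (f x : ℂ) := rfl

theorem norm_c0_le {f : C₀(X, ℂ)} {C : ℝ} (hC : 0 ≤ C) (h : ∀ x, ‖f x‖ ≤ C) : ‖f‖ ≤ C := by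
  rw [← ZeroAtInftyContinuousMap.norm_toBCF_eq_norm]
  exact (BoundedContinuousFunction.norm_le hC).2 h

section Cutoff

variable [ProperSpace X]

theorem hasCompactSupport_of_dist {f : X → ℝ} (p : X) (R : ℝ) (h : ∀ x, R < dist x p → f x = 0) :
    HasCompactSupport f := by
  refine HasCompactSupport.of_support_subset_isCompact (isCompact_closedBall p R) fun x hx => ?_
  by_contra hxR
  exact hx (h x (by simpa using hxR))

/-- A cutoff function, equal to `1` on the closed ball of radius `R` and supported in the closed
ball of radius `R + 1`. -/
def cutoff (p : X) (R : ℝ) : C₀(X, ℂ) :=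
  ofRealC0 (fun x => ramp R (dist x p)) ((continuous_ramp R).comp (by fun_prop))
    (hasCompactSupport_of_dist p (R + 1) fun _ hx => ramp_eq_zero hx.le)

theorem cutoff_apply (p : X) (R : ℝ) (x : X) : cutoff p R x = (ramp R (dist x p) : ℂ) := rfl

theorem cutoff_eq_one {p x : X} {R : ℝ} (h : dist x p ≤ R) : cutoff p R x = 1 := by
  rw [cutoff_apply, ramp_eq_one h, Complex.ofReal_one]

theorem cutoff_eq_zero {p x : X} {R : ℝ} (h : R + 1 ≤ dist x p) : cutoff p R x = 0 := by
  rw [cutoff_apply, ramp_eq_zero h, Complex.ofReal_zero]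

theorem norm_cutoff_apply_le (p : X) (R : ℝ) (x : X) : ‖cutoff p R x‖ ≤ 1 := by
  rw [cutoff_apply, Complex.norm_real, Real.norm_of_nonneg (ramp_nonneg _ _)]
  exact ramp_le_one _ _

theorem norm_cutoff_le (p : X) (R : ℝ) : ‖cutoff p R‖ ≤ 1 :=
  norm_c0_le zero_le_one (norm_cutoff_apply_le p R)

theorem tendsto_cutoff_mul (p : X) (f : C₀(X, ℂ)) :
    Tendsto (fun n : ℕ => cutoff p n * f) atTop (nhds f) := by
  rw [Metric.tendsto_atTop]
  intro ε hε
  have h := f.zero_at_infty'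
  rw [← comap_dist_left_atTop_eq_cocompact p] at h
  have h2 : ∀ᶠ x in comap (dist p) atTop, ‖f x‖ < ε / 2 := by
    have := h (Metric.ball_mem_nhds (0 : ℂ) (half_pos hε))
    filter_upwards [this] with x hx
    simpa using hx
  obtain ⟨N, hN⟩ := (eventually_atTop.1 (eventually_comap.1 h2))
  obtain ⟨n₀, hn₀⟩ := exists_nat_ge N
  refine ⟨n₀, fun n hn => ?_⟩
  rw [dist_eq_norm]
  refine (norm_c0_le (half_pos hε).le fun x => ?_).trans_lt (half_lt_self hε)
  have hx : (cutoff p n * f - f) x = cutoff p n x * f x - f x := rfl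
  rw [hx]
  by_cases hd : dist x p ≤ n
  · rw [cutoff_eq_one hd]
    simpa using (half_pos hε).le
  · have h3 : N ≤ dist p x := by
      rw [dist_comm]
      have : (n₀ : ℝ) ≤ n := by exact_mod_cast hn
      push Not at hd
      linarith
    have h4 := hN _ h3 x rfl
    have h5 : cutoff p n x * f x - f x = ((ramp n (dist x p) - 1 : ℝ) : ℂ) * f x := by
      rw [cutoff_apply]
      push_cast
      ring
    rw [h5, norm_mul, Complex.norm_real]
    have h6 : ‖ramp n (dist x p) - 1‖ ≤ 1 := by
      rw [Real.norm_eq_abs, abs_le]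
      constructor <;> linarith [ramp_nonneg n (dist x p), ramp_le_one n (dist x p)]
    nlinarith [norm_nonneg (f x)]

variable (ρ : C₀(X, ℂ) →⋆ₙₐ[ℂ] (H →L[ℂ] H))

theorem norm_rep_le (f : C₀(X, ℂ)) : ‖ρ f‖ ≤ ‖f‖ := NonUnitalStarAlgHom.norm_apply_le ρ f

theorem norm_rep_apply_le (f : C₀(X, ℂ)) (v : H) : ‖ρ f v‖ ≤ ‖f‖ * ‖v‖ :=
  (ρ f).le_of_opNorm_le (norm_rep_le ρ f) v

theorem rep_mul_apply (f g : C₀(X, ℂ)) (v : H) : ρ (f * g) v = ρ f (ρ g v) := by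
  rw [map_mul]; rfl

theorem continuous_rep : Continuous ρ :=
  AddMonoidHomClass.continuous_of_bound ρ 1 fun f => by simpa using norm_rep_le ρ f

variable {ρ}

theorem tendsto_rep_cutoff (hnd : NondegRep ρ) (p : X) (v : H) :
    Tendsto (fun n : ℕ => ρ (cutoff p n) v) atTop (nhds v) := by
  have hspan : ∀ w ∈ Submodule.span ℂ {w : H | ∃ (f : C₀(X, ℂ)) (v : H), ρ f v = w},
      Tendsto (fun n : ℕ => ρ (cutoff p n) w) atTop (nhds w) := by
    intro w hw
    induction hw using Submodule.span_induction with
    | mem x hx =>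
      obtain ⟨f, v, rfl⟩ := hx
      have h := ((continuous_rep ρ).tendsto f).comp (tendsto_cutoff_mul p f)
      have h2 := ((ContinuousLinearMap.apply ℂ H v).continuous.tendsto (ρ f)).comp h
      refine h2.congr fun n => ?_
      exact rep_mul_apply ρ _ _ _
    | zero => simp
    | add x y _ _ hx hy => simpa using hx.add hy
    | smul c x _ hx => simpa using hx.const_smul c
  rw [Metric.tendsto_atTop]
  intro ε hε
  obtain ⟨w, hw, hvw⟩ := Metric.dense_iff.1 hnd v (ε / 3) (by positivity)
  obtain ⟨N, hN⟩ := Metric.tendsto_atTop.1 (hspan w hvw) (ε / 3) (by positivity)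
  refine ⟨N, fun n hn => ?_⟩
  have h1 := hN n hn
  have h2 : dist (ρ (cutoff p n) v) (ρ (cutoff p n) w) ≤ dist v w := by
    rw [dist_eq_norm, dist_eq_norm, ← map_sub]
    refine (norm_rep_apply_le ρ _ _).trans ?_
    exact mul_le_of_le_one_left (norm_nonneg _) (norm_cutoff_le _ _)
  have h3 : dist v w < ε / 3 := by rw [dist_comm]; exact hw
  have h4 := dist_triangle4 (ρ (cutoff p n) v) (ρ (cutoff p n) w) w v
  rw [dist_comm w v] at h4
  linarith

/-- The vectors of compact support are dense. -/
theorem dense_rep_cutoff_fixed (hnd : NondegRep ρ) (p : X) :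
    Dense {v : H | ∃ n : ℕ, ρ (cutoff p n) v = v} := by
  intro v
  refine mem_closure_of_tendsto (tendsto_rep_cutoff hnd p v) (Eventually.of_forall fun n => ?_)
  refine ⟨n + 1, ?_⟩
  rw [← rep_mul_apply]
  congr 2
  ext x
  change cutoff p (n + 1 : ℕ) x * cutoff p n x = cutoff p n x
  by_cases hx : dist x p ≤ n + 1
  · rw [cutoff_eq_one (by exact_mod_cast hx), one_mul]
  · rw [cutoff_eq_zero (R := n) (not_le.1 hx).le, mul_zero]

theorem tsupport_subset_of_zero {f : C₀(X, ℂ)} {K : Set X} (hK : IsClosed K)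
    (h : ∀ x, x ∉ K → f x = 0) : tsupport ⇑f ⊆ K :=
  closure_minimal (fun x hx => by_contra fun hxK => hx (h x hxK)) hK

/-- An operator of finite propagation maps vectors supported far from a ball to vectors
supported off that ball. -/
theorem HasPropLE.rep_mul_eq (hnd : NondegRep ρ) {T : H →L[ℂ] H} {r : ℝ} (hT : HasPropLE ρ T r)
    {f : C₀(X, ℂ)} {p : X} {m R : ℝ} (hf : ∀ x, m < dist x p → f x = 0) (hR : m + r ≤ R) (v : H) :
    ρ f (T v) = ρ f (T (ρ (cutoff p R) v)) := by
  have hf' : tsupport ⇑f ⊆ closedBall p m :=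
    tsupport_subset_of_zero isClosed_closedBall fun x hx => hf x (by simpa using hx)
  have key (k : ℕ) : ρ f (T (ρ (cutoff p k) v)) = ρ f (T (ρ (cutoff p R) (ρ (cutoff p k) v))) := by
    have h := congrArg (fun A : H →L[ℂ] H => A v)
      (hT f (cutoff p k - cutoff p R * cutoff p k) ?_)
    · rw [map_sub] at h
      have h' : ρ f (T (ρ (cutoff p k) v - ρ (cutoff p R * cutoff p k) v)) = 0 := h
      rw [rep_mul_apply, map_sub, map_sub, sub_eq_zero] at h'
      exact h'
    · have hs : tsupport ⇑(cutoff p k - cutoff p R * cutoff p k) ⊆ {x | R ≤ dist x p} := by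
        refine tsupport_subset_of_zero (isClosed_le continuous_const (by fun_prop)) fun x hx => ?_
        change cutoff p k x - cutoff p R x * cutoff p k x = 0
        rw [cutoff_eq_one (R := R) (not_le.1 hx).le, one_mul, sub_self]
      intro x hx y hy
      have h1 : dist x p ≤ m := hf' hx
      have h2 : R ≤ dist y p := hs hy
      have h3 := dist_triangle y x p
      rw [dist_comm y x] at h3
      linarith
  have hlim := tendsto_rep_cutoff hnd p v
  have hl : Tendsto (fun k : ℕ => ρ f (T (ρ (cutoff p k) v))) atTop (nhds (ρ f (T v))) :=
    ((ρ f * T).continuous.tendsto v).comp hlim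
  have hr : Tendsto (fun k : ℕ => ρ f (T (ρ (cutoff p k) v))) atTop
      (nhds (ρ f (T (ρ (cutoff p R) v)))) := by
    simp only [key]
    exact ((ρ f * T * ρ (cutoff p R)).continuous.tendsto v).comp hlim
  exact tendsto_nhds_unique hl hr

/-! ### Algebra of finite propagation operators -/

theorem HasPropLE.mono {T : H →L[ℂ] H} {r s : ℝ} (hT : HasPropLE ρ T r) (h : r ≤ s) :
    HasPropLE ρ T s :=
  fun f g hfg => hT f g fun x hx y hy => h.trans (hfg x hx y hy)

theorem HasPropLE.add {T S : H →L[ℂ] H} {r s : ℝ} (hT : HasPropLE ρ T r) (hS : HasPropLE ρ S s) :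
    HasPropLE ρ (T + S) (max r s) := fun f g hfg => by
  rw [mul_add, add_mul, hT.mono (le_max_left _ _) f g hfg, hS.mono (le_max_right _ _) f g hfg,
    add_zero]

theorem HasPropLE.smul {T : H →L[ℂ] H} {r : ℝ} (hT : HasPropLE ρ T r) (c : ℂ) :
    HasPropLE ρ (c • T) r := fun f g hfg => by
  rw [mul_smul_comm, smul_mul_assoc, hT f g hfg, smul_zero]

theorem HasPropLE.star {T : H →L[ℂ] H} {r : ℝ} (hT : HasPropLE ρ T r) :
    HasPropLE ρ (star T) r := fun f g hfg => by
  have hsupp (f : C₀(X, ℂ)) : tsupport ⇑(Star.star f) = tsupport ⇑f := by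
    unfold tsupport
    congr 1
    ext x
    simp
  have h := hT (Star.star g) (Star.star f) fun x hx y hy => by
    rw [hsupp] at hx hy
    rw [dist_comm]
    exact hfg y hy x hx
  have h2 := congrArg Star.star h
  simpa [map_star, mul_assoc] using h2

theorem HasPropLE.mul (hnd : NondegRep ρ) {T S : H →L[ℂ] H} {r s : ℝ}
    (hT : HasPropLE ρ T r) (hS : HasPropLE ρ S s) : HasPropLE ρ (T * S) (r + s + 2) := by
  intro f g hfg
  set K := tsupport ⇑g with hK
  rcases K.eq_empty_or_nonempty with hKe | hKn
  · have : g = 0 := by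
      ext x
      exact image_eq_zero_of_notMem_tsupport (by rw [← hK, hKe]; exact Set.notMem_empty x)
    simp [this]
  obtain ⟨p, -⟩ := id hKn
  ext v
  change ρ f (T (S (ρ g v))) = 0
  have hlim := tendsto_rep_cutoff hnd p (S (ρ g v))
  have hl : Tendsto (fun k : ℕ => ρ f (T (ρ (cutoff p k) (S (ρ g v))))) atTop
      (nhds (ρ f (T (S (ρ g v))))) := ((ρ f * T).continuous.tendsto _).comp hlim
  refine tendsto_nhds_unique hl (tendsto_const_nhds.congr fun k => ?_)
  let h : C₀(X, ℂ) := ofRealC0 (fun x => ramp k (dist x p) * ramp s (infDist x K))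
    (((continuous_ramp _).comp (by fun_prop)).mul
      ((continuous_ramp _).comp (continuous_infDist_pt K)))
    (hasCompactSupport_of_dist p (k + 1) fun x hx => by rw [ramp_eq_zero hx.le, zero_mul])
  have hh (x : X) : h x = cutoff p k x * (ramp s (infDist x K) : ℂ) := by
    simp [h, cutoff_apply]
  have h1 : ρ (cutoff p k - h) * S * ρ g = 0 := by
    refine hS _ _ fun x hx y hy => ?_
    have hs : tsupport ⇑(cutoff p k - h) ⊆ {x | s ≤ infDist x K} := by
      refine tsupport_subset_of_zero (isClosed_le continuous_const (continuous_infDist_pt K))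
        fun x hx => ?_
      change cutoff p k x - h x = 0
      rw [hh, ramp_eq_one (not_le.1 hx).le]
      simp
    exact (hs hx).trans (infDist_le_dist_of_mem hy)
  have h2 : ρ (cutoff p k) (S (ρ g v)) = ρ h (S (ρ g v)) := by
    have := congrArg (fun A : H →L[ℂ] H => A v) h1
    rw [map_sub] at this
    exact sub_eq_zero.1 this
  have h3 : ρ f * T * ρ h = 0 := by
    refine hT _ _ fun x hx y hy => ?_
    have hs : tsupport ⇑h ⊆ {x | infDist x K ≤ s + 1} := by
      refine tsupport_subset_of_zero (isClosed_le (continuous_infDist_pt K) continuous_const)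
        fun x hx => ?_
      rw [hh, ramp_eq_zero (not_le.1 hx).le]
      simp
    have hy' : infDist y K < s + 2 := lt_of_le_of_lt (hs hy) (by linarith)
    obtain ⟨z, hz, hyz⟩ := (infDist_lt_iff hKn).1 hy'
    have := hfg x hx z hz
    have := dist_triangle x y z
    linarith
  rw [h2]
  exact (congrArg (fun A : H →L[ℂ] H => A (S (ρ g v))) h3).symm

end Cutoff

/-! ### The Roe algebra as an ideal -/

/-- The `*`-algebra of `Γ`-invariant operators of finite propagation. -/
def FinPropSet (ρ : C₀(X, ℂ) →⋆ₙₐ[ℂ] (H →L[ℂ] H)) (u : Γ →* unitary (H →L[ℂ] H)) :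
    Set (H →L[ℂ] H) :=
  {T | IsEquivariantOp u T ∧ ∃ r : ℝ, 0 ≤ r ∧ HasPropLE ρ T r}

section Ideal

variable [ProperSpace X]
variable {ρ : C₀(X, ℂ) →⋆ₙₐ[ℂ] (H →L[ℂ] H)} {u : Γ →* unitary (H →L[ℂ] H)}
variable {T S a : H →L[ℂ] H}

theorem RoeAlgSet_subset_FinPropSet : RoeAlgSet ρ u ⊆ FinPropSet ρ u := fun _ h => ⟨h.1, h.2.2⟩

theorem StructAlgSet_subset_FinPropSet : StructAlgSet ρ u ⊆ FinPropSet ρ u :=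
  fun _ h => ⟨h.1, h.2.2⟩

theorem RoeAlgSet_subset_StructAlgSet : RoeAlgSet ρ u ⊆ StructAlgSet ρ u :=
  fun _ h => ⟨h.1, fun f => (h.2.1 f).1.sub (h.2.1 f).2, h.2.2⟩

theorem IsEquivariantOp.star (hT : IsEquivariantOp u T) : IsEquivariantOp u (star T) := by
  intro γ
  have h := congrArg Star.star (hT γ⁻¹)
  rw [star_mul, star_mul, map_inv, ← Unitary.coe_star, ← Unitary.star_eq_inv, star_star] at h
  exact h.symm

theorem IsEquivariantOp.add (hT : IsEquivariantOp u T) (hS : IsEquivariantOp u S) :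
    IsEquivariantOp u (T + S) := fun γ => by rw [mul_add, add_mul, hT, hS]

theorem IsEquivariantOp.smul (hT : IsEquivariantOp u T) (c : ℂ) :
    IsEquivariantOp u (c • T) := fun γ => by rw [mul_smul_comm, smul_mul_assoc, hT]

theorem IsEquivariantOp.mul (hT : IsEquivariantOp u T) (hS : IsEquivariantOp u S) :
    IsEquivariantOp u (T * S) := fun γ => by rw [← mul_assoc, hT, mul_assoc, hS, mul_assoc]

theorem add_mem_FinPropSet (hT : T ∈ FinPropSet ρ u) (hS : S ∈ FinPropSet ρ u) :
    T + S ∈ FinPropSet ρ u := by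
  obtain ⟨hT, r, hr, hTr⟩ := hT
  obtain ⟨hS, s, hs, hSs⟩ := hS
  exact ⟨hT.add hS, _, hr.trans (le_max_left _ _), hTr.add hSs⟩

theorem smul_mem_FinPropSet (c : ℂ) (hT : T ∈ FinPropSet ρ u) : c • T ∈ FinPropSet ρ u :=
  let ⟨r, hr, hTr⟩ := hT.2
  ⟨hT.1.smul c, r, hr, hTr.smul c⟩

theorem star_mem_FinPropSet (hT : T ∈ FinPropSet ρ u) : star T ∈ FinPropSet ρ u :=
  let ⟨r, hr, hTr⟩ := hT.2
  ⟨hT.1.star, r, hr, hTr.star⟩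

theorem star_mem_RoeAlgSet (ha : a ∈ RoeAlgSet ρ u) : star a ∈ RoeAlgSet ρ u := by
  obtain ⟨h1, h2, r, hr, h3⟩ := ha
  refine ⟨h1.star, fun f => ⟨?_, ?_⟩, r, hr, h3.star⟩
  · simpa [map_star] using (h2 (star f)).2.star_clm
  · simpa [map_star] using (h2 (star f)).1.star_clm

theorem one_mem_FinPropSet : (1 : H →L[ℂ] H) ∈ FinPropSet ρ u := by
  refine ⟨fun γ => by rw [mul_one, one_mul], 1, zero_le_one, fun f g hfg => ?_⟩
  rw [mul_one, ← map_mul]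
  convert map_zero ρ
  ext x
  by_contra hx
  have hx' := mul_ne_zero_iff.1 hx
  have := hfg x (subset_tsupport _ hx'.1) x (subset_tsupport _ hx'.2)
  rw [dist_self] at this
  linarith

theorem mul_mem_FinPropSet (hnd : NondegRep ρ) (hT : T ∈ FinPropSet ρ u)
    (hS : S ∈ FinPropSet ρ u) : T * S ∈ FinPropSet ρ u := by
  obtain ⟨hT, r, hr, hTr⟩ := hT
  obtain ⟨hS, s, hs, hSs⟩ := hS
  exact ⟨hT.mul hS, _, by positivity, hTr.mul hnd hSs⟩

theorem mul_mem_RoeAlgSet (hnd : NondegRep ρ) (hT : T ∈ FinPropSet ρ u)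
    (ha : a ∈ RoeAlgSet ρ u) : T * a ∈ RoeAlgSet ρ u := by
  have hTa := mul_mem_FinPropSet hnd hT (RoeAlgSet_subset_FinPropSet ha)
  refine ⟨hTa.1, fun f => ⟨?_, (ha.2.1 f).2.clm_comp T⟩, hTa.2⟩
  rcases isEmpty_or_nonempty X with hX | ⟨⟨p⟩⟩
  · have : f = 0 := by ext x; exact hX.elim x
    rw [this, map_zero, zero_mul]
    exact isCompactOperator_zero
  obtain ⟨-, r, hr, hTr⟩ := hT
  have hlim : Tendsto (fun n : ℕ => ρ (cutoff p n * f) * (T * a)) atTop (nhds (ρ f * (T * a))) :=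
    (((continuous_rep ρ).tendsto f).comp (tendsto_cutoff_mul p f)).mul_const _
  refine isCompactOperator_of_tendsto hlim (Eventually.of_forall fun n => ?_)
  have heq : ρ (cutoff p n * f) * (T * a)
      = (ρ (cutoff p n * f) * T) * (ρ (cutoff p (n + 1 + r)) * a) := by
    ext v
    refine hTr.rep_mul_eq hnd (p := p) (m := n + 1) (fun x hx => ?_) le_rfl (a v)
    change cutoff p n x * f x = 0
    rw [cutoff_eq_zero hx.le, zero_mul]
  rw [heq]
  exact (ha.2.1 _).1.clm_comp (ρ (cutoff p n * f) * T)

end Ideal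

/-! ### Extension of representations from the ideal -/

section Extension

variable [ProperSpace X]
variable {ρ : C₀(X, ℂ) →⋆ₙₐ[ℂ] (H →L[ℂ] H)} {u : Γ →* unitary (H →L[ℂ] H)}
variable {K : Type*} [NormedAddCommGroup K] [InnerProductSpace ℂ K] [CompleteSpace K]
variable {σ : (H →L[ℂ] H) → (K →L[ℂ] K)}

/-- The map `Σ aᵢ ⊗ vᵢ ↦ Σ σ(T aᵢ) vᵢ`. -/
def inducedMap (σ : (H →L[ℂ] H) → (K →L[ℂ] K)) (R : Set (H →L[ℂ] H)) (T : H →L[ℂ] H) :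
    (R →₀ K) →ₗ[ℂ] K :=
  Finsupp.lsum ℂ fun a : R => (σ (T * a)).toLinearMap

theorem inducedMap_single (R : Set (H →L[ℂ] H)) (T : H →L[ℂ] H) (a : R) (v : K) :
    inducedMap σ R T (Finsupp.single a v) = σ (T * a) v := by
  simp [inducedMap]

theorem inducedMap_apply (R : Set (H →L[ℂ] H)) (T : H →L[ℂ] H) (x : R →₀ K) :
    inducedMap σ R T x = ∑ a ∈ x.support, σ (T * a) (x a) := by
  simp [inducedMap, Finsupp.sum]

theorem denseRange_inducedMap_one {R : Set (H →L[ℂ] H)} (hσ : IsNondegRepOn R σ) :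
    DenseRange (inducedMap σ R 1) := by
  refine Dense.mono ?_ hσ
  rw [← LinearMap.coe_range]
  refine Submodule.span_le.2 ?_
  rintro _ ⟨a, ha, v, rfl⟩
  exact ⟨Finsupp.single ⟨a, ha⟩ v, by rw [inducedMap_single, one_mul]⟩

theorem eq_of_eq_on_range {R : Set (H →L[ℂ] H)} (hσ : IsNondegRepOn R σ) {A B : K →L[ℂ] K}
    (h : ∀ a ∈ R, A * σ a = B * σ a) : A = B := by
  refine ContinuousLinearMap.ext_on hσ ?_
  rintro _ ⟨a, ha, v, rfl⟩
  exact congrArg (fun A : K →L[ℂ] K => A v) (h a ha)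

theorem inner_inducedMap (hnd : NondegRep ρ) (hσ : IsStarRepOn (RoeAlgSet ρ u) σ)
    (hT : T ∈ FinPropSet ρ u) (x : RoeAlgSet ρ u →₀ K) :
    inner ℂ (inducedMap σ _ T x) (inducedMap σ _ T x) =
      ∑ a ∈ x.support, ∑ b ∈ x.support,
        inner ℂ (x a) (σ (star (a : H →L[ℂ] H) * (star T * T) * b) (x b)) := by
  rw [inducedMap_apply, sum_inner]
  refine Finset.sum_congr rfl fun a _ => ?_
  rw [inner_sum]
  refine Finset.sum_congr rfl fun b _ => ?_
  have ha := mul_mem_RoeAlgSet hnd hT a.2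
  have hb := mul_mem_RoeAlgSet hnd hT b.2
  have h1 : star (a : H →L[ℂ] H) * (star T * T) * b = star (T * a) * (T * b) := by
    rw [star_mul]; simp only [mul_assoc]
  rw [h1, hσ.2.2.1 _ (star_mem_RoeAlgSet ha) _ hb, hσ.2.2.2 _ ha,
    ContinuousLinearMap.star_eq_adjoint, mul_apply_eq_comp,
    ContinuousLinearMap.adjoint_inner_right]

theorem norm_inducedMap_le (hnd : NondegRep ρ) (hσ : IsStarRepOn (RoeAlgSet ρ u) σ)
    {T B : H →L[ℂ] H} (hT : T ∈ FinPropSet ρ u) (hB : B ∈ FinPropSet ρ u) {C : ℝ}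
    (hTB : star T * T + star B * B = (C : ℂ) • 1) (x : RoeAlgSet ρ u →₀ K) :
    ‖inducedMap σ _ T x‖ ≤ Real.sqrt C * ‖inducedMap σ _ 1 x‖ := by
  have h1 : (1 : H →L[ℂ] H) ∈ FinPropSet ρ u := one_mem_FinPropSet
  have hsum : inner ℂ (inducedMap σ _ T x) (inducedMap σ _ T x)
      + inner ℂ (inducedMap σ _ B x) (inducedMap σ _ B x)
      = (C : ℂ) * inner ℂ (inducedMap σ _ 1 x) (inducedMap σ _ 1 x) := by
    rw [inner_inducedMap hnd hσ hT, inner_inducedMap hnd hσ hB, inner_inducedMap hnd hσ h1,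
      ← Finset.sum_add_distrib, Finset.mul_sum]
    refine Finset.sum_congr rfl fun a _ => ?_
    rw [← Finset.sum_add_distrib, Finset.mul_sum]
    refine Finset.sum_congr rfl fun b _ => ?_
    have hmem {S : H →L[ℂ] H} (hS : S ∈ FinPropSet ρ u) :
        star (a : H →L[ℂ] H) * (star S * S) * b ∈ RoeAlgSet ρ u := by
      rw [mul_assoc, mul_assoc]
      exact mul_mem_RoeAlgSet hnd (star_mem_FinPropSet (RoeAlgSet_subset_FinPropSet a.2))
        (mul_mem_RoeAlgSet hnd (star_mem_FinPropSet hS) (mul_mem_RoeAlgSet hnd hS b.2))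
    rw [← inner_add_right, ← add_apply, ← hσ.1 _ (hmem hT) _ (hmem hB), ← add_mul, ← mul_add,
      hTB, ← inner_smul_right, ← smul_apply, ← hσ.2.1 _ _ (hmem h1)]
    simp
  have hinner (z : K) : inner ℂ z z = ((‖z‖ ^ 2 : ℝ) : ℂ) := by
    rw [inner_self_eq_norm_sq_to_K]; push_cast; rfl
  rw [hinner, hinner, hinner] at hsum
  norm_cast at hsum
  refine (Real.le_sqrt_of_sq_le (y := C * ‖inducedMap σ _ 1 x‖ ^ 2) ?_).trans_eq ?_
  · nlinarith [sq_nonneg ‖inducedMap σ (RoeAlgSet ρ u) B x‖]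
  · rw [Real.sqrt_mul' _ (sq_nonneg _), Real.sqrt_sq (norm_nonneg _)]

/-- A nondegenerate `*`-representation of the Roe algebra extends to all invariant operators of
finite propagation, provided each of them is bounded by a scalar in the algebraic sense. -/
theorem exists_extension_of_isBounded (hnd : NondegRep ρ) (hσ : IsStarRepOn (RoeAlgSet ρ u) σ)
    (hσnd : IsNondegRepOn (RoeAlgSet ρ u) σ)
    (hbdd : ∀ T ∈ FinPropSet ρ u, ∃ C : ℝ, ∃ B ∈ FinPropSet ρ u,
      star T * T + star B * B = (C : ℂ) • 1) :
    ∃ τ : (H →L[ℂ] H) → (K →L[ℂ] K), IsStarRepOn (FinPropSet ρ u) τ ∧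
      ∀ T ∈ RoeAlgSet ρ u, τ T = σ T := by
  let τ : (H →L[ℂ] H) → (K →L[ℂ] K) := fun T =>
    (inducedMap σ (RoeAlgSet ρ u) T).extendOfNorm (inducedMap σ (RoeAlgSet ρ u) 1)
  have hτ (T) (hT : T ∈ FinPropSet ρ u) (a) (ha : a ∈ RoeAlgSet ρ u) :
      τ T * σ a = σ (T * a) := by
    ext v
    obtain ⟨C, B, hB, hTB⟩ := hbdd T hT
    have := LinearMap.extendOfNorm_eq (denseRange_inducedMap_one hσnd)
      ⟨_, norm_inducedMap_le hnd hσ hT hB hTB⟩ (Finsupp.single ⟨a, ha⟩ v)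
    rwa [inducedMap_single, inducedMap_single, one_mul] at this
  refine ⟨τ, ⟨fun T hT S hS => ?_, fun c T hT => ?_, fun T hT S hS => ?_, fun T hT => ?_⟩,
    fun T hT => ?_⟩ <;> refine eq_of_eq_on_range hσnd fun a ha => ?_
  · rw [hτ _ (add_mem_FinPropSet hT hS) a ha, add_mul, add_mul, hτ T hT a ha, hτ S hS a ha,
      hσ.1 _ (mul_mem_RoeAlgSet hnd hT ha) _ (mul_mem_RoeAlgSet hnd hS ha)]
  · rw [hτ _ (smul_mem_FinPropSet c hT) a ha, smul_mul_assoc, smul_mul_assoc, hτ T hT a ha,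
      hσ.2.1 _ _ (mul_mem_RoeAlgSet hnd hT ha)]
  · rw [hτ _ (mul_mem_FinPropSet hnd hT hS) a ha, mul_assoc, mul_assoc, hτ S hS a ha,
      hτ T hT _ (mul_mem_RoeAlgSet hnd hS ha)]
  · rw [hτ _ (star_mem_FinPropSet hT) a ha]
    have hstar := star_mem_FinPropSet hT
    refine star_injective (eq_of_eq_on_range hσnd fun b hb => ?_)
    have hTa := mul_mem_RoeAlgSet hnd hstar ha
    rw [← hσ.2.2.2 _ hTa, ← hσ.2.2.1 _ (star_mem_RoeAlgSet hTa) _ hb, star_mul, star_mul,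
      star_star, star_star, mul_assoc, mul_assoc, hτ T hT b hb, ← hσ.2.2.2 _ ha,
      ← hσ.2.2.1 _ (star_mem_RoeAlgSet ha) _ (mul_mem_RoeAlgSet hnd hT hb)]
  · rw [hτ T (RoeAlgSet_subset_FinPropSet hT) a ha, hσ.2.2.1 _ hT _ ha]

/-- Extensions of a nondegenerate representation of the Roe algebra are unique. -/
theorem extension_unique (hnd : NondegRep ρ) (hσnd : IsNondegRepOn (RoeAlgSet ρ u) σ)
    {σ₁ σ₂ : (H →L[ℂ] H) → (K →L[ℂ] K)} (h₁ : IsStarRepOn (StructAlgSet ρ u) σ₁)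
    (h₂ : IsStarRepOn (StructAlgSet ρ u) σ₂) (e₁ : ∀ T ∈ RoeAlgSet ρ u, σ₁ T = σ T)
    (e₂ : ∀ T ∈ RoeAlgSet ρ u, σ₂ T = σ T) {T : H →L[ℂ] H} (hT : T ∈ StructAlgSet ρ u) :
    σ₁ T = σ₂ T := by
  refine eq_of_eq_on_range hσnd fun a ha => ?_
  have hTa := mul_mem_RoeAlgSet hnd (StructAlgSet_subset_FinPropSet hT) ha
  have ha' := RoeAlgSet_subset_StructAlgSet ha
  rw [← e₁ a ha, ← h₁.2.2.1 _ hT _ ha', e₁ a ha, e₁ _ hTa, ← e₂ a ha, ← h₂.2.2.1 _ hT _ ha',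
    e₂ _ hTa]

end Extension

/-! ### Equivariant partitions of unity -/

section Partition

theorem exists_equivariant_net (hiso : ∀ γ : Γ, Isometry fun x : X => γ • x) {a : ℝ} (ha : 0 < a) :
    ∃ Y : Set X, (∀ y ∈ Y, ∀ y' ∈ Y, ∀ γ : Γ, dist (γ • y) y' < a → y = y') ∧
      ∀ x, ∃ y ∈ Y, ∃ γ : Γ, dist x (γ • y) < a := by
  obtain ⟨Y, hY⟩ := zorn_subset
    {Y : Set X | ∀ y ∈ Y, ∀ y' ∈ Y, ∀ γ : Γ, dist (γ • y) y' < a → y = y'} (by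
      intro c hc hchain
      refine ⟨⋃₀ c, ?_, fun s hs => Set.subset_sUnion_of_mem hs⟩
      rintro y ⟨s, hs, hys⟩ y' ⟨s', hs', hys'⟩ γ h
      rcases hchain.total hs hs' with hss | hss
      · exact hc hs' y (hss hys) y' hys' γ h
      · exact hc hs y hys y' (hss hys') γ h)
  refine ⟨Y, hY.prop, fun x => ?_⟩
  by_contra! hx
  have hxY : x ∈ Y := by
    refine hY.le_of_ge (y := insert x Y) ?_ (Set.subset_insert _ _) (Set.mem_insert _ _)
    rintro y (rfl | hy) y' (rfl | hy') γ h
    · rfl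
    · have h2 := hx y' hy' γ⁻¹
      rw [← (hiso γ).dist_eq, smul_inv_smul] at h2
      exact absurd h h2.not_gt
    · have h2 := hx y hy γ
      rw [dist_comm] at h2
      exact absurd h h2.not_gt
    · exact hY.prop y hy y' hy' γ h
  have := hx x hxY 1
  rw [one_smul, dist_self] at this
  linarith

theorem finite_dist_smul_lt [ProperSpace X] [ProperlyDiscontinuousSMul Γ X] (y : X) (a : ℝ) :
    {γ : Γ | dist (γ • y) y < a}.Finite := by
  refine (ProperlyDiscontinuousSMul.finite_disjoint_inter_image
    (isCompact_singleton (x := y)) (isCompact_closedBall y a)).subset fun γ hγ => ?_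
  have h : γ • y ∈ (fun x => γ • x) '' {y} ∩ closedBall y a :=
    ⟨⟨y, rfl, rfl⟩, mem_closedBall.2 (le_of_lt hγ)⟩
  exact ⟨_, h⟩

/-- A weighted equivariant net: the weighted number of net points in balls of fixed radius is
bounded above, and bounded below for large radii. -/
theorem exists_weighted_net [ProperSpace X] [ProperlyDiscontinuousSMul Γ X]
    (hiso : ∀ γ : Γ, Isometry fun x : X => γ • x) (hbg : BoundedGeometry X) :
    ∃ (Y : Set X) (w : Y → ℝ) (a : ℝ), 0 < a ∧ (∀ y, 0 < w y) ∧
      (∀ y y' : Y, ∀ γ : Γ, dist (γ • (y : X)) y' < a → y = y') ∧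
      (∀ x R, {i : Γ × Y | dist x (i.1 • (i.2 : X)) < R}.Finite) ∧
      (∀ R, ∃ N : ℝ, ∀ x, ∀ s : Finset (Γ × Y), (∀ i ∈ s, dist x (i.1 • (i.2 : X)) < R) →
        ∑ i ∈ s, w i.2 ≤ N) ∧
      (∀ x, ∃ s : Finset (Γ × Y), (∀ i ∈ s, dist x (i.1 • (i.2 : X)) ≤ 3 * a) ∧
        1 ≤ ∑ i ∈ s, w i.2) := by
  classical
  obtain ⟨Y₀, c, hc, hY₀, hN⟩ := hbg
  have ha : 0 < 2 * c := by positivity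
  obtain ⟨Y, hsep, hnet⟩ := exists_equivariant_net hiso ha
  have hfin (y : X) : {γ : Γ | dist (γ • y) y < 2 * (2 * c)}.Finite := finite_dist_smul_lt y _
  let G : X → Finset Γ := fun y => (hfin y).toFinset
  have hG (y : X) (γ : Γ) : γ ∈ G y ↔ dist (γ • y) y < 2 * (2 * c) := by simp [G]
  have hGpos (y : X) : 0 < (G y).card :=
    Finset.card_pos.2 ⟨1, (hG y 1).2 (by rw [one_smul, dist_self]; positivity)⟩
  choose f hfY hfd using hY₀
  have hball (x : X) (R : ℝ) (z : X) (h : dist x z < R) : f z ∈ Y₀ ∩ ball x (|R| + c) := by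
    refine ⟨hfY z, mem_ball'.2 ?_⟩
    linarith [dist_triangle x z (f z), hfd z, le_abs_self R]
  have hfib (i j : Γ × Y) (hij : f (i.1 • (i.2 : X)) = f (j.1 • (j.2 : X))) :
      i.2 = j.2 ∧ j.1⁻¹ * i.1 ∈ G i.2 := by
    have h : dist (i.1 • (i.2 : X)) (j.1 • (j.2 : X)) < 2 * c := by
      have h1 := hfd (i.1 • (i.2 : X))
      have h2 := hfd (j.1 • (j.2 : X))
      rw [← hij] at h2
      linarith [dist_triangle_right (i.1 • (i.2 : X)) (j.1 • (j.2 : X)) (f (i.1 • (i.2 : X)))]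
    have h' : dist ((j.1⁻¹ * i.1) • (i.2 : X)) (j.2 : X) < 2 * c := by
      rwa [← (hiso j.1).dist_eq, smul_smul, mul_inv_cancel_left]
    have he : i.2 = j.2 := Subtype.ext (hsep _ i.2.2 _ j.2.2 _ h')
    refine ⟨he, (hG _ _).2 ?_⟩
    rw [← he] at h'
    linarith
  refine ⟨Y, fun y => ((G y).card : ℝ)⁻¹, 2 * c, ha, fun y => by
    have := hGpos y
    positivity, fun y y' γ h => Subtype.ext (hsep _ y.2 _ y'.2 γ h), fun x R => ?_, fun R => ?_,
    fun x => ?_⟩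
  · have hR : 0 < |R| + c := by positivity
    obtain ⟨N, hN⟩ := hN _ hR
    refine Set.Finite.of_finite_fibers (fun i => f (i.1 • (i.2 : X)))
      ((hN x).1.subset ?_) fun z _ => ?_
    · rintro _ ⟨i, hi, rfl⟩
      exact hball x R _ hi
    · rcases Set.eq_empty_or_nonempty
        ({i : Γ × Y | dist x (i.1 • (i.2 : X)) < R} ∩ (fun i => f (i.1 • (i.2 : X))) ⁻¹' {z})
        with he | ⟨j, -, hj⟩
      · rw [he]; exact Set.finite_empty
      · refine ((G j.2).finite_toSet.image fun δ => (j.1 * δ, j.2)).subset ?_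
        rintro i ⟨-, hi⟩
        obtain ⟨h1, h2⟩ := hfib i j (hi.trans hj.symm)
        exact ⟨j.1⁻¹ * i.1, h1 ▸ h2, Prod.ext (mul_inv_cancel_left _ _) h1.symm⟩
  · have hR : 0 < |R| + c := by positivity
    obtain ⟨N, hN⟩ := hN _ hR
    refine ⟨N, fun x s hs => ?_⟩
    have hfinN := (hN x).1
    rw [← Finset.sum_fiberwise_of_maps_to (g := fun i => f (i.1 • (i.2 : X)))
      (t := hfinN.toFinset) (fun i hi => (Set.Finite.mem_toFinset _).2 (hball x R _ (hs i hi)))]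
    have hcard : (hfinN.toFinset.card : ℝ) ≤ N := by
      rw [← Set.ncard_eq_toFinset_card _ hfinN]
      exact_mod_cast (hN x).2
    refine le_trans (Finset.sum_le_card_nsmul _ _ 1 fun z _ => ?_) (by simpa using hcard)
    rcases (s.filter fun i => f (i.1 • (i.2 : X)) = z).eq_empty_or_nonempty with he | ⟨j, hj⟩
    · rw [he]; simp
    · have hj' := (Finset.mem_filter.1 hj).2
      have hmem (i) (hi : i ∈ s.filter fun i => f (i.1 • (i.2 : X)) = z) :
          i.2 = j.2 ∧ j.1⁻¹ * i.1 ∈ G j.2 := by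
        obtain ⟨h1, h2⟩ := hfib i j ((Finset.mem_filter.1 hi).2.trans hj'.symm)
        exact ⟨h1, h1 ▸ h2⟩
      have hle : (s.filter fun i => f (i.1 • (i.2 : X)) = z).card ≤ (G j.2).card := by
        refine Finset.card_le_card_of_injOn (fun i => j.1⁻¹ * i.1) (fun i hi => (hmem i hi).2) ?_
        intro i hi i' hi' h
        exact Prod.ext (mul_left_cancel h) ((hmem i hi).1.trans (hmem i' hi').1.symm)
      have hpos := hGpos j.2
      rw [Finset.sum_congr rfl fun i hi => by rw [(hmem i hi).1], Finset.sum_const, nsmul_eq_mul,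
        ← div_eq_mul_inv]
      exact div_le_one_of_le₀ (by exact_mod_cast hle) (by positivity)
  · obtain ⟨y, hy, γ, hγ⟩ := hnet x
    refine ⟨(G y).image fun δ => (γ * δ, ⟨y, hy⟩), ?_, ?_⟩
    · simp only [Finset.forall_mem_image]
      intro δ hδ
      have h1 := (hG y δ).1 hδ
      rw [← (hiso γ).dist_eq, smul_smul] at h1
      have := dist_triangle_right x ((γ * δ) • y) (γ • y)
      linarith
    · rw [Finset.sum_image fun δ _ δ' _ h => by simpa using h]
      have := hGpos y
      change 1 ≤ ∑ _ ∈ G y, ((G y).card : ℝ)⁻¹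
      rw [Finset.sum_const, nsmul_eq_mul, mul_inv_cancel₀ (by positivity)]

/-- Equivariant partitions of unity with supports of uniformly bounded size and controlled
overlaps. -/
theorem exists_equivariant_partition [ProperSpace X] [ProperlyDiscontinuousSMul Γ X]
    (hiso : ∀ γ : Γ, Isometry fun x : X => γ • x) (hbg : BoundedGeometry X) :
    ∃ (Y : Set X) (w : Y → ℝ) (a : ℝ), 0 < a ∧ (∀ y, 0 < w y) ∧
      (∀ y y' : Y, ∀ γ : Γ, dist (γ • (y : X)) y' < a → y = y') ∧
      (∀ x R, {i : Γ × Y | dist x (i.1 • (i.2 : X)) < R}.Finite) ∧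
      ∀ R, 3 * a ≤ R → ∃ (N : ℝ) (θ : Γ × Y → X → ℝ), 0 ≤ N ∧ (∀ i, Continuous (θ i)) ∧
        (∀ i x, 0 ≤ θ i x) ∧ (∀ i x, θ i x ≤ w i.2) ∧
        (∀ i x, R + 1 ≤ dist x (i.1 • (i.2 : X)) → θ i x = 0) ∧
        (∀ i x, dist x (i.1 • (i.2 : X)) ≤ R → w i.2 ≤ N * θ i x) ∧
        (∀ x (s : Finset (Γ × Y)), (∀ i, θ i x ≠ 0 → i ∈ s) → ∑ i ∈ s, θ i x = 1) ∧
        ∀ (γ : Γ) (i : Γ × Y) x, θ (γ * i.1, i.2) (γ • x) = θ i x := by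
  obtain ⟨Y, w, a, ha, hw, hsep, hfin, hub, hlb⟩ := exists_weighted_net (Γ := Γ) hiso hbg
  refine ⟨Y, w, a, ha, hw, hsep, hfin, fun R hR => ?_⟩
  obtain ⟨N, hN⟩ := hub (R + 1)
  let φ : Γ × Y → X → ℝ := fun i x => w i.2 * ramp R (dist x (i.1 • (i.2 : X)))
  have hφ_cont (i) : Continuous (φ i) :=
    continuous_const.mul ((continuous_ramp R).comp (by fun_prop))
  have hφ_nonneg (i x) : 0 ≤ φ i x := mul_nonneg (hw _).le (ramp_nonneg _ _)
  have hφ_le (i x) : φ i x ≤ w i.2 := mul_le_of_le_one_right (hw _).le (ramp_le_one _ _)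
  have hφ_one (i x) (h : dist x (i.1 • (i.2 : X)) ≤ R) : φ i x = w i.2 := by
    simp only [φ, ramp_eq_one h, mul_one]
  have hφ_zero (i x) (h : R + 1 ≤ dist x (i.1 • (i.2 : X))) : φ i x = 0 := by
    simp only [φ, ramp_eq_zero h, mul_zero]
  have hsupp (x : X) : (Function.support fun i => φ i x) ⊆ (hfin x (R + 1)).toFinset := by
    intro i hi
    rw [Set.Finite.coe_toFinset]
    by_contra h
    exact hi (hφ_zero i x (not_lt.1 h))
  have hlf : LocallyFinite fun i => Function.support (φ i) := by
    intro x
    refine ⟨ball x 1, ball_mem_nhds x one_pos, (hfin x (R + 2)).subset ?_⟩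
    rintro i ⟨z, hz, hzx⟩
    have h1 : dist z (i.1 • (i.2 : X)) < R + 1 := by
      by_contra h
      exact hz (hφ_zero i z (not_lt.1 h))
    have h2 := dist_triangle_left x (i.1 • (i.2 : X)) z
    have h3 := mem_ball.1 hzx
    change dist x (i.1 • (i.2 : X)) < R + 2
    linarith
  let Φ : X → ℝ := fun x => ∑ᶠ i, φ i x
  have hΦ_cont : Continuous Φ := continuous_finsum hφ_cont hlf
  have hΦ_eq (x) : Φ x = ∑ i ∈ (hfin x (R + 1)).toFinset, φ i x :=
    finsum_eq_sum_of_support_subset _ (hsupp x)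
  have hΦ_le (x) : Φ x ≤ N := by
    rw [hΦ_eq]
    exact (Finset.sum_le_sum fun i _ => hφ_le i x).trans (hN x _ fun i hi => by simpa using hi)
  have hΦ_ge (x) : 1 ≤ Φ x := by
    obtain ⟨s, hs, h1⟩ := hlb x
    rw [hΦ_eq]
    refine h1.trans ?_
    rw [Finset.sum_congr rfl fun i hi => (hφ_one i x ((hs i hi).trans hR)).symm]
    refine Finset.sum_le_sum_of_subset_of_nonneg (fun i hi => ?_) fun i _ _ => hφ_nonneg i x
    rw [Set.Finite.mem_toFinset]
    change dist x (i.1 • (i.2 : X)) < R + 1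
    linarith [hs i hi]
  have hΦ_pos (x) : 0 < Φ x := one_pos.trans_le (hΦ_ge x)
  have hφ_inv (γ : Γ) (i : Γ × Y) (x) : φ (γ * i.1, i.2) (γ • x) = φ i x := by
    simp only [φ, mul_smul, (hiso γ).dist_eq]
  have hΦ_inv (γ : Γ) (x) : Φ (γ • x) = Φ x := by
    let e : Γ × Y ≃ Γ × Y := (Equiv.mulLeft γ).prodCongr (Equiv.refl Y)
    simp only [Φ]
    rw [← finsum_comp_equiv e]
    exact finsum_congr fun i => hφ_inv γ i x
  refine ⟨max N 0, fun i x => φ i x / Φ x, le_max_right _ _,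
    fun i => (hφ_cont i).div hΦ_cont fun x => (hΦ_pos x).ne',
    fun i x => div_nonneg (hφ_nonneg i x) (hΦ_pos x).le,
    fun i x => (div_le_self (hφ_nonneg i x) (hΦ_ge x)).trans (hφ_le i x),
    fun i x h => by beta_reduce; rw [hφ_zero i x h, zero_div], fun i x h => ?_, fun x s hs => ?_,
    fun γ i x => by beta_reduce; rw [hφ_inv, hΦ_inv]⟩
  · beta_reduce
    rw [hφ_one i x h, ← mul_div_assoc, le_div_iff₀ (hΦ_pos x), mul_comm]
    exact mul_le_mul_of_nonneg_right ((hΦ_le x).trans (le_max_left _ _)) (hw _).le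
  · rw [← Finset.sum_div, div_eq_one_iff_eq (hΦ_pos x).ne']
    refine (finsum_eq_sum_of_support_subset _ fun i hi => hs i ?_).symm
    exact div_ne_zero hi (hΦ_pos x).ne'

end Partition

/-! ### Orthogonal equivariant families of isometries -/

section Isometries

/-- The translate `x ↦ f (γ • x)` of a function in `C₀(X, ℂ)` by an isometric action. -/
def translateC0 (hiso : ∀ γ : Γ, Isometry fun x : X => γ • x) (γ : Γ) (f : C₀(X, ℂ)) :
    C₀(X, ℂ) where
  toFun x := f (γ • x)
  continuous_toFun := f.continuous_toFun.comp (hiso γ).continuous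
  zero_at_infty' := by
    let e : X ≃ᵢ X := ⟨MulAction.toPerm γ, hiso γ⟩
    exact f.zero_at_infty'.comp e.toHomeomorph.isClosedEmbedding.tendsto_cocompact

theorem translateC0_apply (hiso : ∀ γ : Γ, Isometry fun x : X => γ • x) (γ : Γ) (f : C₀(X, ℂ))
    (x : X) : translateC0 hiso γ f x = f (γ • x) := rfl

variable {ρ : C₀(X, ℂ) →⋆ₙₐ[ℂ] (H →L[ℂ] H)} {u : Γ →* unitary (H →L[ℂ] H)}

theorem CovariantRep.rep_unitary_apply (hcov : CovariantRep ρ u) {γ : Γ} {f g : C₀(X, ℂ)}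
    (h : ∀ x, f x = g (γ • x)) (v : H) :
    ρ g ((u γ : H →L[ℂ] H) v) = (u γ : H →L[ℂ] H) (ρ f v) := by
  have h1 := hcov γ f g fun x => by rw [h, smul_inv_smul]
  have h2 : ρ g * (u γ : H →L[ℂ] H) = (u γ : H →L[ℂ] H) * ρ f := by
    rw [h1, mul_assoc, Unitary.coe_star_mul_self, mul_one]
  exact congrArg (fun A : H →L[ℂ] H => A v) h2

theorem AmpleRep.of_forall_coord {H₁ : Type*} [NormedAddCommGroup H₁] [InnerProductSpace ℂ H₁]
    [CompleteSpace H₁] {ρ₁ : C₀(X, ℂ) →⋆ₙₐ[ℂ] (H₁ →L[ℂ] H₁)} (hample₁ : AmpleRep ρ₁)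
    (U : H ≃ₗᵢ[ℂ] lp (fun _ : ℕ => H₁) 2)
    (hU : ∀ (f : C₀(X, ℂ)) (v : H) (n : ℕ), (U (ρ f v)) n = ρ₁ f ((U v) n)) :
    AmpleRep ρ := by
  intro f hf
  refine hample₁ f ?_
  let S : H₁ →L[ℂ] H := (U.symm.toContinuousLinearEquiv : _ →L[ℂ] H).comp
    (lp.singleContinuousLinearMap ℂ (fun _ : ℕ => H₁) 2 0)
  let E : H →L[ℂ] H₁ := (lp.evalCLM ℂ (fun _ : ℕ => H₁) 2 0).comp
    (U.toContinuousLinearEquiv : H →L[ℂ] _)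
  have h : ⇑(ρ₁ f) = ⇑E ∘ (⇑(ρ f) ∘ ⇑S) := by
    ext w
    change _ = U (ρ f (U.symm (lp.single 2 0 w))) 0
    rw [hU, LinearIsometryEquiv.apply_symm_apply, lp.single_apply_self]
  rw [h]
  exact (hf.comp_clm S).clm_comp E

theorem AmpleRep.not_finiteDimensional (hample : AmpleRep ρ) {f : C₀(X, ℂ)} (hf : f ≠ 0) :
    ¬ FiniteDimensional ℂ (ρ f).range.topologicalClosure := by
  intro hfin
  refine hf (hample f ?_)
  set K := (ρ f).range.topologicalClosure
  have : ProperSpace K := FiniteDimensional.proper ℂ K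
  let A : H →L[ℂ] K := (ρ f).codRestrict K fun v => subset_closure ⟨v, rfl⟩
  exact (isCompactOperator_of_locallyCompactSpace_dom A).clm_comp K.subtypeL

theorem exists_separation_radius [ProperSpace X] [ProperlyDiscontinuousSMul Γ X]
    (hfree : ∀ (γ : Γ) (x : X), γ • x = x → γ = 1) (y : X) {a : ℝ} (ha : 0 < a) :
    ∃ ε : ℝ, 0 < ε ∧ ε ≤ a ∧ ∀ γ : Γ, γ ≠ 1 → ε ≤ dist (γ • y) y := by
  have hfin := (finite_dist_smul_lt (Γ := Γ) y a).subset (Set.sdiff_subset (t := {1}))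
  have h : ∀ᶠ ε in nhdsWithin (0 : ℝ) (Set.Ioi 0),
      ∀ γ ∈ {γ : Γ | dist (γ • y) y < a} \ {1}, ε ≤ dist (γ • y) y := by
    rw [eventually_all_finite hfin]
    rintro γ ⟨-, hγ⟩
    have hpos : 0 < dist (γ • y) y := dist_pos.2 fun h => hγ (hfree γ y h)
    exact nhdsWithin_le_nhds (Iic_mem_nhds hpos)
  obtain ⟨ε, ⟨h1, h2⟩, h3⟩ :=
    ((h.and (nhdsWithin_le_nhds (Iic_mem_nhds ha))).and self_mem_nhdsWithin).exists
  refine ⟨ε, h3, h2, fun γ hγ => ?_⟩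
  by_cases hlt : dist (γ • y) y < a
  · exact h1 γ ⟨hlt, hγ⟩
  · exact le_trans h2 (not_lt.1 hlt)

theorem exists_equivariant_isometries [ProperSpace X] [ProperlyDiscontinuousSMul Γ X]
    [TopologicalSpace.SeparableSpace H]
    (hiso : ∀ γ : Γ, Isometry fun x : X => γ • x)
    (hfree : ∀ (γ : Γ) (x : X), γ • x = x → γ = 1)
    (hcov : CovariantRep ρ u) (hample : AmpleRep ρ) {Y : Set X} {a : ℝ} (ha : 0 < a)
    (hsep : ∀ y y' : Y, ∀ γ : Γ, dist (γ • (y : X)) y' < a → y = y') :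
    ∃ J : Γ × Y → H →ₗᵢ[ℂ] H, OrthogonalFamily ℂ (fun _ => H) J ∧
      (∀ (γ : Γ) (i : Γ × Y) v, J (γ * i.1, i.2) v = (u γ : H →L[ℂ] H) (J i v)) ∧
      ∀ (i : Γ × Y) (f : C₀(X, ℂ)), (∀ x, dist x (i.1 • (i.2 : X)) ≤ 1 → f x = 0) →
        ∀ v, ρ f (J i v) = 0 := by
  have hmin : 0 < min a 1 := lt_min ha one_pos
  choose ε hε hεa hεγ using fun y : X => exists_separation_radius (Γ := Γ) hfree y hmin
  let b : X → X → ℝ := fun y x => max 0 (ε y / 2 - dist x y)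
  have hb_zero (y x) (h : ε y / 2 ≤ dist x y) : b y x = 0 := max_eq_left (by linarith)
  let p : X → C₀(X, ℂ) := fun y => ofRealC0 (b y) (by fun_prop)
    (hasCompactSupport_of_dist y (ε y / 2) fun x hx => hb_zero y x hx.le)
  have hp_ne (y) : p y ≠ 0 := by
    intro h
    have h1 : p y y = 0 := by rw [h]; rfl
    have h2 : b y y = 0 := Complex.ofReal_eq_zero.1 h1
    have h3 : ε y / 2 - dist y y ≤ b y y := le_max_right _ _
    rw [h2, dist_self] at h3
    linarith [hε y]
  let E := fun y => (exists_linearIsometry_of_not_finiteDimensional (H := H)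
    (hample.not_finiteDimensional (hp_ne y))).some
  let J₀ : X → H →ₗᵢ[ℂ] H := fun y => (Submodule.subtypeₗᵢ _).comp (E y)
  have hJ₀ (y v) : J₀ y v ∈ closure (Set.range (ρ (p y))) := (E y v).2
  let J : Γ × Y → H →ₗᵢ[ℂ] H := fun i =>
    (Unitary.linearIsometryEquiv (u i.1)).toLinearIsometry.comp (J₀ i.2)
  have hJ (i v) : J i v = (u i.1 : H →L[ℂ] H) (J₀ i.2 v) := rfl
  have hann (i : Γ × Y) (f : C₀(X, ℂ)) (hf : ∀ x, f (i.1 • x) * p i.2 x = 0) (v) :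
      ρ f (J i v) = 0 := by
    rw [hJ, hcov.rep_unitary_apply (translateC0_apply hiso i.1 f)]
    have hcl : IsClosed {w : H | ρ (translateC0 hiso i.1 f) w = 0} :=
      isClosed_eq (by fun_prop) continuous_const
    have hw : J₀ i.2 v ∈ {w : H | ρ (translateC0 hiso i.1 f) w = 0} := by
      refine hcl.closure_subset_iff.2 ?_ (hJ₀ i.2 v)
      rintro _ ⟨z, rfl⟩
      have h0 : translateC0 hiso i.1 f * p i.2 = 0 := by ext x; exact hf x
      change ρ _ (ρ _ z) = 0
      rw [← rep_mul_apply, h0, map_zero]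
      rfl
    rw [hw, map_zero]
  refine ⟨J, fun i j hij v w => ?_, fun γ i v => ?_, fun i f hf v => hann i f (fun x => ?_) v⟩
  · have hdist : ε i.2 / 2 + ε j.2 / 2 ≤ dist (i.1 • (i.2 : X)) (j.1 • (j.2 : X)) := by
      rw [← (hiso j.1⁻¹).dist_eq]
      simp only [smul_smul, inv_mul_cancel, one_smul]
      by_cases hy : i.2 = j.2
      · have hγ : j.1⁻¹ * i.1 ≠ 1 := fun h =>
          hij (Prod.ext (inv_mul_eq_one.1 h).symm hy)
        have := hεγ (i.2 : X) _ hγ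
        rw [← hy]
        linarith
      · have := not_lt.1 fun h => hy (hsep i.2 j.2 (j.1⁻¹ * i.1) h)
        have h1 := (hεa i.2).trans (min_le_left _ _)
        have h2 := (hεa j.2).trans (min_le_left _ _)
        linarith
    have hcl : IsClosed {z : H | inner ℂ ((u i.1 : H →L[ℂ] H) z) (J j w) = 0} :=
      isClosed_eq (by fun_prop) continuous_const
    refine hcl.closure_subset_iff.2 ?_ (hJ₀ i.2 v)
    rintro _ ⟨z, rfl⟩
    have htr (x) : p i.2 x = translateC0 hiso i.1⁻¹ (p i.2) (i.1 • x) := by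
      rw [translateC0_apply, inv_smul_smul]
    change inner ℂ ((u i.1 : H →L[ℂ] H) (ρ (p i.2) z)) (J j w) = 0
    rw [← hcov.rep_unitary_apply htr, ← ContinuousLinearMap.adjoint_inner_right,
      ← ContinuousLinearMap.star_eq_adjoint, ← map_star, hann, inner_zero_right]
    intro x
    change star (p i.2 (i.1⁻¹ • j.1 • x)) * p j.2 x = 0
    have h1 := dist_triangle_left (i.1 • (i.2 : X)) (j.1 • (j.2 : X)) (j.1 • x)
    rw [(hiso j.1).dist_eq, ← (hiso i.1⁻¹).dist_eq (j.1 • x), inv_smul_smul] at h1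
    by_cases h2 : ε i.2 / 2 ≤ dist (i.1⁻¹ • j.1 • x) i.2
    · have : p i.2 (i.1⁻¹ • j.1 • x) = 0 := by
        change ((b _ _ : ℝ) : ℂ) = 0
        rw [hb_zero _ _ h2, Complex.ofReal_zero]
      rw [this, star_zero, zero_mul]
    · have : p j.2 x = 0 := by
        change ((b _ _ : ℝ) : ℂ) = 0
        rw [hb_zero _ _ (by linarith), Complex.ofReal_zero]
      rw [this, mul_zero]
  · rw [hJ, hJ, map_mul]
    rfl
  · by_cases h : ε i.2 / 2 ≤ dist x i.2
    · have : p i.2 x = 0 := by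
        change ((b _ _ : ℝ) : ℂ) = 0
        rw [hb_zero _ _ h, Complex.ofReal_zero]
      rw [this, mul_zero]
    · rw [hf, zero_mul]
      rw [(hiso i.1).dist_eq]
      have := (hεa i.2).trans (min_le_right _ _)
      linarith [hε i.2]

end Isometries

/-! ### Bounding finite propagation operators by scalars -/

section Bound

theorem c0_sum_apply {ι : Type*} (F : Finset ι) (f : ι → C₀(X, ℂ)) (x : X) :
    (∑ i ∈ F, f i) x = ∑ i ∈ F, f i x := by
  classical
  induction F using Finset.induction_on with
  | empty => simp
  | insert i F hi ih =>
    rw [Finset.sum_insert hi, Finset.sum_insert hi, ← ih]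
    rfl

theorem star_mul_self_add_eq_smul {T B : H →L[ℂ] H} {C : ℝ}
    (h : ∀ v, ‖B v‖ ^ 2 = C * ‖v‖ ^ 2 - ‖T v‖ ^ 2) :
    star T * T + star B * B = (C : ℂ) • 1 := by
  have hinner (z : H) : inner ℂ z z = ((‖z‖ ^ 2 : ℝ) : ℂ) := by
    rw [inner_self_eq_norm_sq_to_K]; push_cast; rfl
  refine ContinuousLinearMap.coe_injective ((ext_inner_map _ _).1 fun v => ?_)
  change inner ℂ (star T (T v) + star B (B v)) v = inner ℂ ((C : ℂ) • v) v
  rw [inner_add_left, ContinuousLinearMap.star_eq_adjoint, ContinuousLinearMap.star_eq_adjoint,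
    ContinuousLinearMap.adjoint_inner_left, ContinuousLinearMap.adjoint_inner_left,
    inner_smul_left, Complex.conj_ofReal, hinner, hinner, hinner, h]
  push_cast
  ring

theorem exists_norm_sq_eq_sub {K L : H →L[ℂ] H} (h : ∀ v, ‖L v‖ ^ 2 ≤ ‖K v‖ ^ 2) :
    ∃ A : H →L[ℂ] H, ∀ v, ‖A v‖ ^ 2 = ‖K v‖ ^ 2 - ‖L v‖ ^ 2 := by
  have hre (S : H →L[ℂ] H) (v : H) : RCLike.re (inner ℂ ((star S * S) v) v) = ‖S v‖ ^ 2 := by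
    rw [mul_apply_eq_comp, ContinuousLinearMap.star_eq_adjoint,
      ContinuousLinearMap.adjoint_inner_left, inner_self_eq_norm_sq]
  have hpos : 0 ≤ star K * K - star L * L := by
    rw [ContinuousLinearMap.nonneg_iff_isPositive, ContinuousLinearMap.isPositive_def']
    refine ⟨(IsSelfAdjoint.star_mul_self K).sub (IsSelfAdjoint.star_mul_self L), fun v => ?_⟩
    rw [ContinuousLinearMap.reApplyInnerSelf_apply, sub_apply, inner_sub_left, map_sub, hre, hre]
    linarith [h v]
  obtain ⟨A, hA⟩ := CStarAlgebra.nonneg_iff_eq_star_mul_self.1 hpos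
  refine ⟨A, fun v => ?_⟩
  rw [← hre, ← hA, sub_apply, inner_sub_left, map_sub, hre, hre]

variable {ρ : C₀(X, ℂ) →⋆ₙₐ[ℂ] (H →L[ℂ] H)} {u : Γ →* unitary (H →L[ℂ] H)}
variable [ProperSpace X]

theorem norm_rep_apply_sq (f : C₀(X, ℂ)) (v : H) :
    ‖ρ f v‖ ^ 2 = RCLike.re (inner ℂ v (ρ (star f * f) v)) := by
  rw [rep_mul_apply, map_star, ContinuousLinearMap.star_eq_adjoint,
    ContinuousLinearMap.adjoint_inner_right, inner_self_eq_norm_sq]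

theorem norm_rep_sq_le {f g : C₀(X, ℂ)} {c : ℝ} (h : ∀ x, ‖f x‖ ^ 2 ≤ c * ‖g x‖ ^ 2) (v : H) :
    ‖ρ f v‖ ^ 2 ≤ c * ‖ρ g v‖ ^ 2 := by
  have hcont {k : C₀(X, ℂ)} : Continuous k := k.continuous_toFun
  let k : C₀(X, ℂ) :=
    { toFun := fun x => (√(c * ‖g x‖ ^ 2 - ‖f x‖ ^ 2) : ℂ)
      continuous_toFun := by
        have := hcont (k := f)
        have := hcont (k := g)
        fun_prop
      zero_at_infty' := by
        have h1 := (((((zero_at_infty g).norm.pow 2).const_mul c).sub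
          ((zero_at_infty f).norm.pow 2)).sqrt).ofReal
        simpa using h1 }
  have hk : (c : ℂ) • (star g * g) = star f * f + star k * k := by
    ext x
    have hstar (z : ℂ) : star z * z = ((‖z‖ ^ 2 : ℝ) : ℂ) := by
      push_cast
      exact Complex.conj_mul' z
    change (c : ℂ) * (star (g x) * g x) = star (f x) * f x + star (k x) * k x
    rw [hstar, hstar, hstar]
    have : ‖k x‖ ^ 2 = c * ‖g x‖ ^ 2 - ‖f x‖ ^ 2 := by
      change ‖((√(c * ‖g x‖ ^ 2 - ‖f x‖ ^ 2) : ℝ) : ℂ)‖ ^ 2 = _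
      rw [Complex.norm_real, Real.norm_of_nonneg (Real.sqrt_nonneg _),
        Real.sq_sqrt (sub_nonneg.2 (h x))]
    rw [this]
    push_cast
    ring
  have h1 := congrArg (fun F => RCLike.re (inner ℂ v (ρ F v))) hk
  simp only [map_smul, map_add, smul_apply, add_apply, inner_add_right,
    inner_smul_right] at h1
  rw [← norm_rep_apply_sq, ← norm_rep_apply_sq] at h1
  have h2 : RCLike.re ((c : ℂ) * inner ℂ v (ρ (star g * g) v)) = c * ‖ρ g v‖ ^ 2 := by
    rw [norm_rep_apply_sq]
    exact Complex.re_ofReal_mul _ _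
  rw [h2] at h1
  nlinarith [sq_nonneg ‖ρ k v‖]

theorem hasSum_norm_rep_sq (hnd : NondegRep ρ) {ι : Type*} {s : ι → C₀(X, ℂ)}
    (p : X) (hloc : ∀ n : ℝ, ∃ F : Finset ι, ∀ i ∉ F, ∀ x, dist x p < n → s i x = 0)
    (hsum : ∀ x (F : Finset ι), (∀ i ∉ F, s i x = 0) → ∑ i ∈ F, star (s i x) * s i x = 1)
    (v : H) : HasSum (fun i => ‖ρ (s i) v‖ ^ 2) (‖v‖ ^ 2) := by
  rw [← one_mul (‖v‖ ^ 2)]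
  refine hasSum_norm_sq_of_dense (fun i => ρ (s i)) 1 (dense_rep_cutoff_fixed hnd p) ?_ v
  rintro v ⟨n, hn⟩
  obtain ⟨F, hF⟩ := hloc (n + 1)
  have hterm (i) : ‖ρ (s i) v‖ ^ 2 = ‖ρ (s i * cutoff p n) v‖ ^ 2 := by rw [rep_mul_apply, hn]
  have hone : 1 * ‖v‖ ^ 2 = ∑ i ∈ F, ‖ρ (s i) v‖ ^ 2 := by
    rw [Finset.sum_congr rfl fun i _ => hterm i,
      Finset.sum_congr rfl fun i _ => norm_rep_apply_sq _ _, ← map_sum, ← inner_sum]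
    have heq : ∑ i ∈ F, star (s i * cutoff p n) * (s i * cutoff p n)
        = star (cutoff p n) * cutoff p n := by
      ext x
      have hcoe : (∑ i ∈ F, star (s i * cutoff p n) * (s i * cutoff p n)) x
          = ∑ i ∈ F, star (s i x * cutoff p n x) * (s i x * cutoff p n x) := by
        rw [c0_sum_apply]
        rfl
      rw [hcoe]
      change _ = star (cutoff p n x) * cutoff p n x
      by_cases hx : dist x p < n + 1
      · rw [← one_mul (star (cutoff p n x) * cutoff p n x), ← hsum x F fun i hi => hF i hi x hx,
          Finset.sum_mul]
        refine Finset.sum_congr rfl fun i _ => ?_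
        rw [star_mul]
        ring
      · rw [cutoff_eq_zero (not_lt.1 hx)]
        simp
    have hv : ∑ i ∈ F, ρ (star (s i * cutoff p n) * (s i * cutoff p n)) v
        = ρ (star (cutoff p n) * cutoff p n) v := by
      rw [← heq, map_sum, sum_apply]
    rw [hv, ← norm_rep_apply_sq, hn, one_mul]
  rw [hone]
  refine hasSum_sum_of_ne_finset_zero fun i hi => ?_
  have h0 : s i * cutoff p n = 0 := by
    ext x
    change s i x * cutoff p n x = 0
    by_cases hx : dist x p < n + 1
    · rw [hF i hi x hx, zero_mul]
    · rw [cutoff_eq_zero (not_lt.1 hx), mul_zero]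
  rw [hterm, h0, map_zero]
  simp

end Bound

section KeyBound

variable [ProperSpace X] [ProperlyDiscontinuousSMul Γ X] [TopologicalSpace.SeparableSpace H]
variable {ρ : C₀(X, ℂ) →⋆ₙₐ[ℂ] (H →L[ℂ] H)} {u : Γ →* unitary (H →L[ℂ] H)}

/-- Equivariant partitions of unity in `C₀(X, ℂ)`, in the form of functions whose squares sum
to `1`. -/
theorem exists_sqrt_partition {Y : Set X} {w : Y → ℝ} {R N : ℝ} {θ : Γ × Y → X → ℝ}
    (hfin : ∀ x R, {i : Γ × Y | dist x (i.1 • (i.2 : X)) < R}.Finite)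
    (hcont : ∀ i, Continuous (θ i)) (hpos : ∀ i x, 0 ≤ θ i x)
    (hle : ∀ i x, θ i x ≤ w i.2)
    (hzero : ∀ i x, R + 1 ≤ dist x (i.1 • (i.2 : X)) → θ i x = 0)
    (hge : ∀ i x, dist x (i.1 • (i.2 : X)) ≤ R → w i.2 ≤ N * θ i x)
    (hsum : ∀ x (s : Finset (Γ × Y)), (∀ i, θ i x ≠ 0 → i ∈ s) → ∑ i ∈ s, θ i x = 1)
    (hinv : ∀ (γ : Γ) (i : Γ × Y) x, θ (γ * i.1, i.2) (γ • x) = θ i x)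
    (hnd : NondegRep ρ) (hcov : CovariantRep ρ u) [Nonempty X] :
    ∃ s : Γ × Y → C₀(X, ℂ), (∀ i x, ‖s i x‖ ^ 2 ≤ w i.2) ∧
      (∀ i x, R + 1 ≤ dist x (i.1 • (i.2 : X)) → s i x = 0) ∧
      (∀ i x, dist x (i.1 • (i.2 : X)) ≤ R → w i.2 ≤ N * ‖s i x‖ ^ 2) ∧
      (∀ v, HasSum (fun i => ‖ρ (s i) v‖ ^ 2) (‖v‖ ^ 2)) ∧
      ∀ (γ : Γ) (y : Y) v, ρ (s (1, y)) ((u γ⁻¹ : H →L[ℂ] H) v)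
        = (u γ⁻¹ : H →L[ℂ] H) (ρ (s (γ, y)) v) := by
  let s : Γ × Y → C₀(X, ℂ) := fun i => ofRealC0 (fun x => √(θ i x)) (hcont i).sqrt
    (hasCompactSupport_of_dist (i.1 • (i.2 : X)) (R + 1) fun x hx => by
      rw [hzero i x hx.le, Real.sqrt_zero])
  have hs (i x) : s i x = (√(θ i x) : ℂ) := rfl
  have hs2 (i x) : ‖s i x‖ ^ 2 = θ i x := by
    rw [hs, Complex.norm_real, Real.norm_of_nonneg (Real.sqrt_nonneg _), Real.sq_sqrt (hpos i x)]
  have hs0 (i x) : s i x = 0 ↔ θ i x = 0 := by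
    rw [← norm_eq_zero, ← sq_eq_zero_iff, hs2]
  refine ⟨s, fun i x => (hs2 i x).trans_le (hle i x), fun i x h => (hs0 i x).2 (hzero i x h),
    fun i x h => by rw [hs2]; exact hge i x h, ?_, fun γ y v => ?_⟩
  · obtain ⟨p⟩ := ‹Nonempty X›
    refine hasSum_norm_rep_sq hnd p (fun n => ?_) fun x F hF => ?_
    · refine ⟨(hfin p (n + (R + 1))).toFinset, fun i hi x hx => ?_⟩
      rw [Set.Finite.mem_toFinset] at hi
      refine (hs0 i x).2 (hzero i x ?_)
      have h1 : n + (R + 1) ≤ dist p (i.1 • (i.2 : X)) := not_lt.1 hi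
      have h2 := dist_triangle_left p (i.1 • (i.2 : X)) x
      linarith
    · have hstar (i) : star (s i x) * s i x = ((θ i x : ℝ) : ℂ) := by
        rw [← hs2]
        push_cast
        exact Complex.conj_mul' _
      rw [Finset.sum_congr rfl fun i _ => hstar i]
      have h1 := hsum x F fun i hi => by
        by_contra hiF
        exact hi ((hs0 i x).1 (hF i hiF))
      exact_mod_cast h1
  · refine hcov.rep_unitary_apply (fun x => ?_) v
    have h1 := hinv γ (1, y) (γ⁻¹ • x)
    rw [mul_one, smul_inv_smul] at h1
    rw [hs, hs, ← h1]

theorem exists_star_mul_self_add_eq_smul [Nonempty X]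
    (hiso : ∀ γ : Γ, Isometry fun x : X => γ • x)
    (hfree : ∀ (γ : Γ) (x : X), γ • x = x → γ = 1)
    (hbg : BoundedGeometry X) (hnd : NondegRep ρ) (hcov : CovariantRep ρ u)
    (hample : AmpleRep ρ) {T : H →L[ℂ] H} (hT : T ∈ FinPropSet ρ u) :
    ∃ C : ℝ, ∃ B ∈ FinPropSet ρ u, star T * T + star B * B = (C : ℂ) • 1 := by
  obtain ⟨hTu, r, hr, hTr⟩ := hT
  obtain ⟨Y, w, a, ha, hw, hsep, hfin, hpart⟩ := exists_equivariant_partition (Γ := Γ) hiso hbg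
  obtain ⟨J, hJo, hJu, hJs⟩ := exists_equivariant_isometries hiso hfree hcov hample ha hsep
  set R := 3 * a + r + 2 with hR
  obtain ⟨N₀, θ₀, -, k1, k2, k3, k4, k5, k6, k7⟩ := hpart (3 * a) le_rfl
  obtain ⟨s, hs_le, hs_zero, -, hs_sum, hs_inv⟩ :=
    exists_sqrt_partition hfin k1 k2 k3 k4 k5 k6 k7 hnd hcov
  obtain ⟨N, θ, hN, h1, h2, h3, h4, h5, h6, h7⟩ := hpart R (by linarith)
  obtain ⟨t, -, ht_zero, ht_ge, ht_sum, ht_inv⟩ :=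
    exists_sqrt_partition hfin h1 h2 h3 h4 h5 h6 h7 hnd hcov
  set C := ‖T‖ ^ 2 * N with hC
  have hC0 : 0 ≤ C := by positivity
  have hdom (i : Γ × Y) (v : H) : ‖ρ (s i) (T v)‖ ^ 2 ≤ C * ‖ρ (t i) v‖ ^ 2 := by
    set e := cutoff (i.1 • (i.2 : X)) (3 * a + 1 + r)
    have hwi := hw i.2
    rw [hTr.rep_mul_eq hnd (p := i.1 • (i.2 : X)) (m := 3 * a + 1)
      (fun x hx => hs_zero i x hx.le) le_rfl]
    have hsn : ‖s i‖ ≤ √(w i.2) := norm_c0_le (Real.sqrt_nonneg _) fun x =>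
      Real.le_sqrt_of_sq_le (hs_le i x)
    have hb1 : ‖ρ (s i) (T (ρ e v))‖ ≤ √(w i.2) * (‖T‖ * ‖ρ e v‖) :=
      (norm_rep_apply_le ρ _ _).trans
        (mul_le_mul hsn (T.le_opNorm _) (norm_nonneg _) (Real.sqrt_nonneg _))
    have hb2 : ‖ρ (s i) (T (ρ e v))‖ ^ 2 ≤ w i.2 * (‖T‖ ^ 2 * ‖ρ e v‖ ^ 2) := by
      refine (pow_le_pow_left₀ (norm_nonneg _) hb1 2).trans_eq ?_
      rw [mul_pow, mul_pow, Real.sq_sqrt hwi.le]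
    have hb3 : ‖ρ e v‖ ^ 2 ≤ N / w i.2 * ‖ρ (t i) v‖ ^ 2 := by
      refine norm_rep_sq_le (fun x => ?_) v
      by_cases hx : dist x (i.1 • (i.2 : X)) ≤ R
      · have he : ‖e x‖ ^ 2 ≤ 1 := pow_le_one₀ (norm_nonneg _) (norm_cutoff_apply_le _ _ _)
        refine he.trans ?_
        rw [div_mul_eq_mul_div, one_le_div hwi]
        exact ht_ge i x hx
      · have he : e x = 0 := cutoff_eq_zero (by linarith)
        rw [he, norm_zero, zero_pow two_ne_zero]
        positivity
    calc _ ≤ w i.2 * (‖T‖ ^ 2 * (N / w i.2 * ‖ρ (t i) v‖ ^ 2)) := hb2.trans (by gcongr)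
      _ = C * ‖ρ (t i) v‖ ^ 2 := by rw [hC]; field_simp
  have hsqrt (i : Γ × Y) (v : H) : ‖((√C : ℂ) • ρ (t i)) v‖ ^ 2 = C * ‖ρ (t i) v‖ ^ 2 := by
    rw [smul_apply, norm_smul, mul_pow, Complex.norm_real,
      Real.norm_of_nonneg (Real.sqrt_nonneg _), Real.sq_sqrt hC0]
  choose A₀ hA₀ using fun y : Y => exists_norm_sq_eq_sub (K := (√C : ℂ) • ρ (t (1, y)))
    (L := ρ (s (1, y)) * T) fun v => by rw [hsqrt]; exact hdom (1, y) v
  let A : Γ × Y → H →L[ℂ] H := fun i => A₀ i.2 * (u i.1⁻¹ : H →L[ℂ] H)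
  have hu (γ : Γ) (v : H) : ‖(u γ : H →L[ℂ] H) v‖ = ‖v‖ :=
    (Unitary.linearIsometryEquiv (u γ)).norm_map v
  have hTu' (γ : Γ) (v : H) : T ((u γ : H →L[ℂ] H) v) = (u γ : H →L[ℂ] H) (T v) :=
    congrArg (fun A : H →L[ℂ] H => A v) (hTu γ).symm
  have hA (i v) : ‖A i v‖ ^ 2 = C * ‖ρ (t i) v‖ ^ 2 - ‖ρ (s i) (T v)‖ ^ 2 := by
    have h := hA₀ i.2 ((u i.1⁻¹ : H →L[ℂ] H) v)
    rw [hsqrt, ht_inv, hu, mul_apply_eq_comp, hTu', hs_inv, hu] at h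
    exact h
  have hAu (γ : Γ) (i : Γ × Y) (v) : A (γ * i.1, i.2) ((u γ : H →L[ℂ] H) v) = A i v := by
    have h : (u (γ * i.1)⁻¹ : H →L[ℂ] H) * (u γ : H →L[ℂ] H) = (u i.1⁻¹ : H →L[ℂ] H) := by
      rw [← Submonoid.coe_mul, ← map_mul, mul_inv_rev, inv_mul_cancel_right]
    change A₀ i.2 (((u (γ * i.1)⁻¹ : H →L[ℂ] H) * (u γ : H →L[ℂ] H)) v) = _
    rw [h]
    rfl
  obtain ⟨B, hB, hBn⟩ := exists_clm_hasSum_of_orthogonalFamily hJo A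
    (fun v => C * ‖v‖ ^ 2 - ‖T v‖ ^ 2) C (fun v => by nlinarith [sq_nonneg ‖T v‖]) fun v => by
      simp only [hA]
      exact ((ht_sum v).mul_left C).sub (hs_sum (T v))
  refine ⟨C, B, ⟨fun γ => ?_, R + 3, by linarith, fun f g hfg => ?_⟩, star_mul_self_add_eq_smul hBn⟩
  · ext v
    let e : Γ × Y ≃ Γ × Y := (Equiv.mulLeft γ).prodCongr (Equiv.refl Y)
    have h1 := (hB v).mapL (u γ : H →L[ℂ] H)
    have h2 := e.hasSum_iff.2 (hB ((u γ : H →L[ℂ] H) v))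
    have h3 : (fun i => J i (A i ((u γ : H →L[ℂ] H) v))) ∘ e =
        fun i => (u γ : H →L[ℂ] H) (J i (A i v)) := by
      funext i
      change J (γ * i.1, i.2) (A (γ * i.1, i.2) ((u γ : H →L[ℂ] H) v)) = _
      rw [hAu, hJu]
    rw [h3] at h2
    exact h1.unique h2
  · ext v
    have h1 := (hB (ρ g v)).mapL (ρ f)
    have h4 (i) : ρ f (J i (A i (ρ g v))) = 0 := by
      by_cases hf : ∀ x, dist x (i.1 • (i.2 : X)) ≤ 1 → f x = 0
      · exact hJs i f hf _
      · push Not at hf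
        obtain ⟨x, hx, hfx⟩ := hf
        have h0 : t i * g = 0 := by
          ext z
          by_contra hz
          have hz' := mul_ne_zero_iff.1 hz
          have hd := hfg x (subset_tsupport _ hfx) z (subset_tsupport _ hz'.2)
          refine hz'.1 (ht_zero i z ?_)
          linarith [dist_triangle_right x z (i.1 • (i.2 : X))]
        have h2 := hA i (ρ g v)
        rw [← rep_mul_apply ρ (t i), h0, map_zero, zero_apply, norm_zero] at h2
        have h3 : A i (ρ g v) = 0 := by
          rw [← norm_eq_zero, ← sq_eq_zero_iff]
          nlinarith [sq_nonneg ‖A i (ρ g v)‖, sq_nonneg ‖ρ (s i) (T (ρ g v))‖]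
        rw [h3, map_zero, map_zero]
    simp only [h4] at h1
    exact h1.unique hasSum_zero

end KeyBound

/-- Every nondegenerate `*`-representation of `ℝ(X)^Γ` on a Hilbert space
`H₀` extends in a unique way to a `*`-representation of `𝕊(X)^Γ` on `H₀`.
The representation `ρ` of `C₀(X)` is assumed very ample (a countably infinite direct sum
of copies of an ample representation `ρ₁`, expressed via the unitary `U : H ≅ ℓ²(ℕ, H₁)`). -/
theorem nondeg_rep_of_Roe_extends_uniquely_to_structure_algebra
    [ProperSpace X] [TopologicalSpace.SeparableSpace X]
    [ProperlyDiscontinuousSMul Γ X]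
    (hiso : ∀ γ : Γ, Isometry fun x : X => γ • x)
    (hfree : ∀ (γ : Γ) (x : X), γ • x = x → γ = 1)
    (hbg : BoundedGeometry X)
    [TopologicalSpace.SeparableSpace H]
    (ρ : C₀(X, ℂ) →⋆ₙₐ[ℂ] (H →L[ℂ] H)) (u : Γ →* unitary (H →L[ℂ] H))
    (hnd : NondegRep ρ) (hcov : CovariantRep ρ u)
    -- `ρ` is very ample
    {H₁ : Type} [NormedAddCommGroup H₁] [InnerProductSpace ℂ H₁] [CompleteSpace H₁]
    (ρ₁ : C₀(X, ℂ) →⋆ₙₐ[ℂ] (H₁ →L[ℂ] H₁)) (hample₁ : AmpleRep ρ₁)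
    (U : H ≃ₗᵢ[ℂ] lp (fun _ : ℕ => H₁) 2)
    (hU : ∀ (f : C₀(X, ℂ)) (v : H) (n : ℕ), (U (ρ f v)) n = ρ₁ f ((U v) n)) :
    ∀ (H₀ : Type) [NormedAddCommGroup H₀] [InnerProductSpace ℂ H₀] [CompleteSpace H₀]
      (σ : (H →L[ℂ] H) → (H₀ →L[ℂ] H₀)),
      IsStarRepOn (RoeAlgSet ρ u) σ → IsNondegRepOn (RoeAlgSet ρ u) σ →
      -- existence of an extension to `𝕊(X)^Γ` …
      (∃ σext : (H →L[ℂ] H) → (H₀ →L[ℂ] H₀),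
        IsStarRepOn (StructAlgSet ρ u) σext ∧ ∀ T ∈ RoeAlgSet ρ u, σext T = σ T) ∧
      -- … and its uniqueness
      (∀ σ₁ σ₂ : (H →L[ℂ] H) → (H₀ →L[ℂ] H₀),
        IsStarRepOn (StructAlgSet ρ u) σ₁ → IsStarRepOn (StructAlgSet ρ u) σ₂ →
        (∀ T ∈ RoeAlgSet ρ u, σ₁ T = σ T) → (∀ T ∈ RoeAlgSet ρ u, σ₂ T = σ T) →
        ∀ T ∈ StructAlgSet ρ u, σ₁ T = σ₂ T) := by
  intro H₀ _ _ _ σ hσ hσnd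
  have hample : AmpleRep ρ := hample₁.of_forall_coord U hU
  have hbdd : ∀ T ∈ FinPropSet ρ u, ∃ C : ℝ, ∃ B ∈ FinPropSet ρ u,
      star T * T + star B * B = (C : ℂ) • 1 := by
    intro T hT
    rcases isEmpty_or_nonempty X with hX | hX
    · have hzero (f : C₀(X, ℂ)) : f = 0 := by
        ext x
        exact hX.elim x
      have hspan : {w : H | ∃ (f : C₀(X, ℂ)) (v : H), ρ f v = w} ⊆ {0} := by
        rintro _ ⟨f, v, rfl⟩
        rw [hzero f, map_zero]
        rfl
      have hv (v : H) : v = 0 := by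
        have hmem := hnd v
        rwa [(Submodule.span_eq_bot.2 fun w hw => hspan hw), Submodule.bot_coe,
          closure_singleton] at hmem
      exact ⟨0, 1, one_mem_FinPropSet, by ext v; rw [hv v, map_zero, map_zero]⟩
    · exact exists_star_mul_self_add_eq_smul hiso hfree hbg hnd hcov hample hT
  refine ⟨?_, fun σ₁ σ₂ h₁ h₂ e₁ e₂ T hT => extension_unique hnd hσnd h₁ h₂ e₁ e₂ hT⟩
  obtain ⟨τ, ⟨hadd, hsmul, hmul, hstar⟩, hτ⟩ := exists_extension_of_isBounded hnd hσ hσnd hbdd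
  have hsub := StructAlgSet_subset_FinPropSet (ρ := ρ) (u := u)
  exact ⟨τ, ⟨fun T hT S hS => hadd T (hsub hT) S (hsub hS), fun c T hT => hsmul c T (hsub hT),
    fun T hT S hS => hmul T (hsub hT) S (hsub hS), fun T hT => hstar T (hsub hT)⟩, hτ⟩
end
end

section
/- Every Γ-invariant pseudolocal operator T ∈ B(H) can be written as T = S + C, where S ∈ 𝕊(X)^Γ is a Γ-invariant pseudolocal operator of finite propagation and C is a Γ-invariant locally compact operator. (Equivalently, 𝔇*(X)^Γ = 𝕊(X)^Γ + ℭ*(X)^Γ, where 𝔇*(X)^Γ is the C*-algebra of Γ-invariant pseudolocal operators and ℭ*(X)^Γ the C*-algebra of Γ-invariant locally compact operators.) -/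
open scoped ZeroAtInfty
open Metric Filter

noncomputable section

variable {X : Type*} [MetricSpace X] {Γ : Type*} [Group Γ] [MulAction Γ X]
variable {H : Type*} [NormedAddCommGroup H] [InnerProductSpace ℂ H] [CompleteSpace H]

/-- For an isometric action there is an invariant set whose points in distinct orbits are
`1`-separated and which is `1`-dense. -/
theorem exists_invariant_net (hiso : ∀ γ : Γ, Isometry fun x : X => γ • x) :
    ∃ Z : Set X, (∀ (γ : Γ), ∀ z ∈ Z, γ • z ∈ Z) ∧
      (∀ a ∈ Z, ∀ b ∈ Z, b ∈ MulAction.orbit Γ a ∨ 1 ≤ dist a b) ∧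
      ∀ x, ∃ z ∈ Z, dist x z < 1 := by
  obtain ⟨Z, hZ⟩ := zorn_subset {Z : Set X | (∀ (γ : Γ), ∀ z ∈ Z, γ • z ∈ Z) ∧
      ∀ a ∈ Z, ∀ b ∈ Z, b ∈ MulAction.orbit Γ a ∨ 1 ≤ dist a b} (by
    intro c hc hchain
    refine ⟨⋃₀ c, ⟨?_, ?_⟩, fun s hs => Set.subset_sUnion_of_mem hs⟩
    · rintro γ z ⟨s, hs, hz⟩
      exact ⟨s, hs, (hc hs).1 γ z hz⟩
    · rintro a ⟨s, hs, ha⟩ b ⟨t, ht, hb⟩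
      rcases hchain.total hs ht with h | h
      · exact (hc ht).2 a (h ha) b hb
      · exact (hc hs).2 a ha b (h hb))
  obtain ⟨hinv, hsep⟩ := hZ.prop
  refine ⟨Z, hinv, hsep, ?_⟩
  by_contra! hx
  obtain ⟨x, hx⟩ := hx
  have hfar : ∀ γ : Γ, ∀ z ∈ Z, 1 ≤ dist (γ • x) z := by
    intro γ z hz
    have h := hx (γ⁻¹ • z) (hinv _ z hz)
    rwa [← (hiso γ).dist_eq, smul_inv_smul] at h
  have hmem : Z ∪ MulAction.orbit Γ x ⊆ Z := by
    refine hZ.le_of_ge (y := Z ∪ MulAction.orbit Γ x) ⟨?_, ?_⟩ Set.subset_union_left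
    · rintro γ z (hz | hz)
      · exact Or.inl (hinv γ z hz)
      · exact Or.inr (MulAction.mem_orbit_of_mem_orbit γ hz)
    · rintro a (ha | ⟨γ, rfl⟩) b (hb | ⟨δ, rfl⟩)
      · exact hsep a ha b hb
      · exact Or.inr (dist_comm a (δ • x) ▸ hfar δ a ha)
      · exact Or.inr (hfar γ b hb)
      · refine Or.inl ⟨δ * γ⁻¹, ?_⟩
        simp [mul_smul]
  have := hx x (hmem (Or.inr (MulAction.mem_orbit_self x)))
  rw [dist_self] at this
  linarith

/-- Under a properly discontinuous action, an invariant set whose distinct orbits are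
`1`-separated meets every compact set in a finite set. -/
theorem finite_inter_of_orbits_separated [ProperlyDiscontinuousSMul Γ X] {Z : Set X}
    (hsep : ∀ a ∈ Z, ∀ b ∈ Z, b ∈ MulAction.orbit Γ a ∨ 1 ≤ dist a b)
    {K : Set X} (hK : IsCompact K) : (Z ∩ K).Finite := by
  obtain ⟨t, -, htfin, htK⟩ := hK.finite_cover_balls (e := 1 / 2) (by norm_num)
  refine (htfin.biUnion (t := fun c => Z ∩ K ∩ ball c (1 / 2)) fun c _ => ?_).subset ?_
  · rcases (Z ∩ K ∩ ball c (1 / 2)).eq_empty_or_nonempty with h | ⟨a, ⟨haZ, haK⟩, hac⟩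
    · rw [h]; exact Set.finite_empty
    refine ((ProperlyDiscontinuousSMul.finite_disjoint_inter_image (Γ := Γ) hK hK).image
      (fun γ => γ • a)).subset ?_
    rintro b ⟨⟨hbZ, hbK⟩, hbc⟩
    rcases hsep a haZ b hbZ with ⟨γ, rfl⟩ | h
    · exact ⟨γ, ⟨γ • a, ⟨a, haK, rfl⟩, hbK⟩, rfl⟩
    · have := dist_triangle_right a b c
      rw [mem_ball] at hac hbc
      linarith
  · intro x hx
    obtain ⟨c, hc, hxc⟩ := Set.mem_iUnion₂.1 (htK hx.2)
    exact Set.mem_biUnion hc ⟨hx, hxc⟩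

/-- A family in `C₀(X)` of compactly supported real functions whose squares form a locally finite
partition of unity. -/
structure IsSquarePartition {ι : Type*} (φ : ι → C₀(X, ℂ)) : Prop where
  star_eq : ∀ i, star (φ i) = φ i
  hasCompactSupport : ∀ i, HasCompactSupport (φ i)
  norm_sum_le : ∀ F : Finset ι, ‖∑ i ∈ F, φ i * φ i‖ ≤ 1
  exists_finset : ∀ K : Set X, IsCompact K → ∃ F : Finset ι,
    (∀ i ∉ F, ∀ x ∈ K, φ i x = 0) ∧ ∀ x ∈ K, ∑ i ∈ F, φ i x * φ i x = 1

theorem ZeroAtInftyContinuousMap.norm_le_of_forall {f : C₀(X, ℂ)} {c : ℝ} (hc : 0 ≤ c)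
    (h : ∀ x, ‖f x‖ ≤ c) : ‖f‖ ≤ c := by
  rw [← ZeroAtInftyContinuousMap.norm_toBCF_eq_norm]
  exact (BoundedContinuousFunction.norm_le hc).2 h

theorem ZeroAtInftyContinuousMap.norm_apply_le_norm (f : C₀(X, ℂ)) (x : X) : ‖f x‖ ≤ ‖f‖ := by
  rw [← ZeroAtInftyContinuousMap.norm_toBCF_eq_norm]
  exact f.toBCF.norm_coe_le_norm x

theorem ZeroAtInftyContinuousMap.sum_apply {ι : Type*} (F : Finset ι) (φ : ι → C₀(X, ℂ)) (x : X) :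
    (∑ i ∈ F, φ i) x = ∑ i ∈ F, φ i x :=
  map_sum (⟨⟨fun f : C₀(X, ℂ) => f x, rfl⟩, fun _ _ => rfl⟩ : C₀(X, ℂ) →+ ℂ) φ F

/-- An isometric, properly discontinuous action on a proper metric space admits an equivariant
square partition of unity with supports of uniformly bounded radius. -/
theorem exists_equivariant_squarePartition [ProperSpace X] [ProperlyDiscontinuousSMul Γ X]
    (hiso : ∀ γ : Γ, Isometry fun x : X => γ • x) :
    ∃ φ : X → C₀(X, ℂ), IsSquarePartition φ ∧
      (∀ z x, 2 ≤ dist x z → φ z x = 0) ∧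
      ∀ (γ : Γ) (z x : X), φ (γ • z) x = φ z (γ⁻¹ • x) := by
  classical
  obtain ⟨Z, hinv, hsep, hdense⟩ := exists_invariant_net hiso
  set ψ : X → X → ℝ := fun z x => if z ∈ Z then max 0 (2 - dist x z) else 0 with hψ
  have hψ0 : ∀ z x, 0 ≤ ψ z x := by
    intro z x; simp only [hψ]; split_ifs <;> simp
  have hψc : ∀ z, Continuous (ψ z) := by
    intro z; simp only [hψ]; split_ifs <;> fun_prop
  have hψfar : ∀ z x, 2 ≤ dist x z → ψ z x = 0 := by
    intro z x h; simp only [hψ]; split_ifs <;> simp [h]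
  have hψfin : ∀ K : Set X, IsCompact K → {z | ∃ x ∈ K, ψ z x ≠ 0}.Finite := by
    intro K hK
    refine (finite_inter_of_orbits_separated hsep
      (hK.isBounded.cthickening (δ := 2)).isCompact_closure).subset ?_
    rintro z ⟨x, hx, hzx⟩
    refine ⟨by by_contra h; simp [hψ, h] at hzx, subset_closure ?_⟩
    by_contra h
    refine hzx (hψfar z x ?_)
    by_contra! hd
    exact h (mem_cthickening_of_dist_le z x 2 K hx (by rw [dist_comm]; exact hd.le))
  have hψinv : ∀ (γ : Γ) (z x : X), ψ (γ • z) x = ψ z (γ⁻¹ • x) := by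
    intro γ z x
    have h1 : γ • z ∈ Z ↔ z ∈ Z := ⟨fun h => by simpa using hinv γ⁻¹ _ h, hinv γ z⟩
    have h2 : dist x (γ • z) = dist (γ⁻¹ • x) z := by
      rw [← (hiso γ).dist_eq (γ⁻¹ • x), smul_inv_smul]
    simp only [hψ, h1, h2]
  set σ : X → ℝ := fun x => ∑ᶠ z, ψ z x with hσ
  have hσK : ∀ K : Set X, IsCompact K → ∃ F : Finset X, (∀ z ∉ F, ∀ x ∈ K, ψ z x = 0) ∧
      ∀ x ∈ K, σ x = ∑ z ∈ F, ψ z x := by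
    intro K hK
    refine ⟨(hψfin K hK).toFinset, fun z hz x hx => ?_, fun x hx => ?_⟩
    · by_contra h; exact hz (by simpa using ⟨x, hx, h⟩)
    · refine finsum_eq_sum_of_support_subset _ fun z hz => ?_
      simpa using ⟨x, hx, hz⟩
  have hσc : Continuous σ := by
    refine continuous_finsum hψc fun x => ⟨closedBall x 1, closedBall_mem_nhds x one_pos, ?_⟩
    refine (hψfin _ (isCompact_closedBall x 1)).subset ?_
    rintro z ⟨y, hy, hyx⟩
    exact ⟨y, hyx, hy⟩
  have hσpos : ∀ x, 0 < σ x := by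
    intro x
    obtain ⟨F, hF, hs⟩ := hσK {x} isCompact_singleton
    obtain ⟨z, hz, hxz⟩ := hdense x
    have hpos : 0 < ψ z x := by
      simp only [hψ, hz, if_true]
      exact lt_max_of_lt_right (by linarith)
    rw [hs x rfl]
    refine Finset.sum_pos' (fun z _ => hψ0 z x) ⟨z, ?_, hpos⟩
    by_contra h
    exact hpos.ne' (hF z h x rfl)
  have hσle : ∀ (F : Finset X) x, ∑ z ∈ F, ψ z x ≤ σ x := by
    intro F x
    obtain ⟨G, hG, hs⟩ := hσK {x} isCompact_singleton
    rw [hs x rfl, Finset.sum_subset (Finset.subset_union_right (s₁ := F))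
      (fun z _ hz => hG z hz x rfl)]
    exact Finset.sum_le_sum_of_subset_of_nonneg Finset.subset_union_left fun z _ _ => hψ0 z x
  have hσinv : ∀ (γ : Γ) x, σ (γ⁻¹ • x) = σ x := by
    intro γ x
    simp only [hσ]
    rw [← finsum_comp_equiv (MulAction.toPerm γ) (f := fun z => ψ z x)]
    simp [hψinv]
  set p : X → X → ℂ := fun z x => (√(ψ z x / σ x) : ℝ) with hp
  have hpc : ∀ z, Continuous (p z) := fun z =>
    Complex.continuous_ofReal.comp ((hψc z).div hσc fun x => (hσpos x).ne').sqrt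
  have hpfar : ∀ z x, 2 ≤ dist x z → p z x = 0 := by
    intro z x h; simp [hp, hψfar z x h]
  have hps : ∀ z, HasCompactSupport (p z) := fun z =>
    HasCompactSupport.intro (isCompact_closedBall z 2) fun x hx =>
      hpfar z x (by rw [mem_closedBall, not_le] at hx; exact hx.le)
  have hpsq : ∀ z x, p z x * p z x = ((ψ z x / σ x : ℝ) : ℂ) := by
    intro z x
    rw [← Complex.ofReal_mul, Real.mul_self_sqrt (div_nonneg (hψ0 z x) (hσpos x).le)]
  refine ⟨fun z => ⟨⟨p z, hpc z⟩, (hps z).is_zero_at_infty⟩, ⟨?_, hps, ?_, ?_⟩, hpfar, ?_⟩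
  · intro z
    ext x
    exact Complex.conj_ofReal _
  · intro F
    refine ZeroAtInftyContinuousMap.norm_le_of_forall zero_le_one fun x => ?_
    rw [ZeroAtInftyContinuousMap.sum_apply]
    change ‖∑ z ∈ F, p z x * p z x‖ ≤ 1
    simp_rw [hpsq]
    rw [← Complex.ofReal_sum, Complex.norm_real, ← Finset.sum_div, Real.norm_of_nonneg
      (div_nonneg (Finset.sum_nonneg fun z _ => hψ0 z x) (hσpos x).le)]
    exact (div_le_one (hσpos x)).2 (hσle F x)
  · intro K hK
    obtain ⟨F, hF, hs⟩ := hσK K hK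
    refine ⟨F, fun z hz x hx => ?_, fun x hx => ?_⟩
    · change p z x = 0
      simp [hp, hF z hz x hx]
    · change ∑ z ∈ F, p z x * p z x = 1
      simp_rw [hpsq]
      rw [← Complex.ofReal_sum, ← Finset.sum_div, ← hs x hx, div_self (hσpos x).ne',
        Complex.ofReal_one]
  · intro γ z x
    change p (γ • z) x = p z (γ⁻¹ • x)
    simp only [hp, hψinv, hσinv]

section Compression

variable {ι : Type*} {φ : ι → C₀(X, ℂ)}
  (ρ : C₀(X, ℂ) →⋆ₙₐ[ℂ] (H →L[ℂ] H))

namespace IsSquarePartition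

theorem inner_rep (hφ : IsSquarePartition φ) (i : ι) (v w : H) :
    inner ℂ (ρ (φ i) v) w = inner ℂ v (ρ (φ i) w) := by
  have h : star (ρ (φ i)) = ρ (φ i) := by rw [← map_star, hφ.star_eq]
  conv_lhs => rw [← h, ContinuousLinearMap.star_eq_adjoint]
  exact ContinuousLinearMap.adjoint_inner_left _ _ _

theorem sum_norm_rep_sq_le (hφ : IsSquarePartition φ) (F : Finset ι) (v : H) :
    ∑ i ∈ F, ‖ρ (φ i) v‖ ^ 2 ≤ ‖v‖ ^ 2 := by
  have h1 : ((∑ i ∈ F, ‖ρ (φ i) v‖ ^ 2 : ℝ) : ℂ) = inner ℂ v (ρ (∑ i ∈ F, φ i * φ i) v) := by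
    rw [map_sum, _root_.sum_apply, inner_sum]
    push_cast
    refine Finset.sum_congr rfl fun i _ => ?_
    rw [map_mul, mul_apply_eq_comp, ← hφ.inner_rep ρ, inner_self_eq_norm_sq_to_K]
    rfl
  have h2 : ‖ρ (∑ i ∈ F, φ i * φ i) v‖ ≤ ‖v‖ := by
    refine (ContinuousLinearMap.le_opNorm _ _).trans (mul_le_of_le_one_left (norm_nonneg v) ?_)
    exact (NonUnitalStarAlgHom.norm_apply_le ρ _).trans (hφ.norm_sum_le F)
  calc ∑ i ∈ F, ‖ρ (φ i) v‖ ^ 2 ≤ ‖((∑ i ∈ F, ‖ρ (φ i) v‖ ^ 2 : ℝ) : ℂ)‖ := by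
        rw [Complex.norm_real]; exact Real.le_norm_self _
    _ ≤ ‖v‖ * ‖ρ (∑ i ∈ F, φ i * φ i) v‖ := by rw [h1]; exact norm_inner_le_norm _ _
    _ ≤ ‖v‖ ^ 2 := by rw [sq]; gcongr

theorem norm_sum_rep_sq_le (hφ : IsSquarePartition φ) (F : Finset ι) (w : ι → H) :
    ‖∑ i ∈ F, ρ (φ i) (w i)‖ ^ 2 ≤ ∑ i ∈ F, ‖w i‖ ^ 2 := by
  set y := ∑ i ∈ F, ρ (φ i) (w i) with hy
  have h1 : ‖y‖ ^ 2 ≤ ∑ i ∈ F, ‖ρ (φ i) y‖ * ‖w i‖ := by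
    have h : ((‖y‖ ^ 2 : ℝ) : ℂ) = ∑ i ∈ F, inner ℂ (ρ (φ i) y) (w i) := by
      simp_rw [hφ.inner_rep ρ]
      rw [← inner_sum, ← hy, inner_self_eq_norm_sq_to_K]
      push_cast
      rfl
    calc ‖y‖ ^ 2 ≤ ‖((‖y‖ ^ 2 : ℝ) : ℂ)‖ := by
          rw [Complex.norm_real]; exact Real.le_norm_self _
      _ ≤ ∑ i ∈ F, ‖ρ (φ i) y‖ * ‖w i‖ := by
          rw [h]
          exact (_root_.norm_sum_le _ _).trans (Finset.sum_le_sum fun i _ => norm_inner_le_norm _ _)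
  have h2 := Finset.sum_mul_sq_le_sq_mul_sq F (fun i => ‖ρ (φ i) y‖) fun i => ‖w i‖
  have h3 := hφ.sum_norm_rep_sq_le ρ F y
  have h4 : 0 ≤ ∑ i ∈ F, ‖w i‖ ^ 2 := by positivity
  have h5 : (‖y‖ ^ 2) ^ 2 ≤ ‖y‖ ^ 2 * ∑ i ∈ F, ‖w i‖ ^ 2 :=
    (pow_le_pow_left₀ (by positivity) h1 2).trans (h2.trans (by gcongr))
  by_contra! hlt
  nlinarith [sq_nonneg ‖y‖]

/-- The strongly convergent sum `∑ φᵢ T φᵢ`. -/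
theorem exists_compression (hφ : IsSquarePartition φ) (T : H →L[ℂ] H) :
    ∃ S : H →L[ℂ] H, ∀ v, HasSum (fun i => ρ (φ i) (T (ρ (φ i) v))) (S v) := by
  have hbound : ∀ (F : Finset ι) v, ‖∑ i ∈ F, ρ (φ i) (T (ρ (φ i) v))‖ ^ 2 ≤
      ‖T‖ ^ 2 * ∑ i ∈ F, ‖ρ (φ i) v‖ ^ 2 := by
    intro F v
    refine (hφ.norm_sum_rep_sq_le ρ F _).trans ?_
    rw [Finset.mul_sum]
    refine Finset.sum_le_sum fun i _ => ?_
    rw [← mul_pow]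
    gcongr
    exact T.le_opNorm _
  have hsq : ∀ v, Summable fun i => ‖ρ (φ i) v‖ ^ 2 := fun v =>
    summable_of_sum_le (fun _ => by positivity) fun F => hφ.sum_norm_rep_sq_le ρ F v
  have hsum : ∀ v, Summable fun i => ρ (φ i) (T (ρ (φ i) v)) := by
    intro v
    rw [summable_iff_vanishing_norm]
    intro ε hε
    obtain ⟨s, hs⟩ := summable_iff_vanishing_norm.1 ((hsq v).mul_left (‖T‖ ^ 2)) (ε ^ 2)
      (by positivity)
    refine ⟨s, fun t ht => ?_⟩
    refine lt_of_pow_lt_pow_left₀ 2 hε.le (((hbound t v).trans ?_).trans_lt (hs t ht))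
    rw [Finset.mul_sum]
    exact Real.le_norm_self _
  refine ⟨LinearMap.mkContinuous
    { toFun := fun v => ∑' i, ρ (φ i) (T (ρ (φ i) v))
      map_add' := fun v w => by
        simp only [map_add]
        exact (hsum v).tsum_add (hsum w)
      map_smul' := fun c v => by
        simp only [map_smul, RingHom.id_apply]
        exact (hsum v).tsum_const_smul c } ‖T‖ fun v => ?_, fun v => (hsum v).hasSum⟩
  refine le_of_tendsto (hsum v).hasSum.norm (Filter.Eventually.of_forall fun F => ?_)
  refine le_of_sq_le_sq ?_ (by positivity)
  rw [mul_pow]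
  exact (hbound F v).trans (by gcongr; exact hφ.sum_norm_rep_sq_le ρ F v)

theorem exists_hasCompactSupport_norm_sub_lt (hφ : IsSquarePartition φ) (f : C₀(X, ℂ)) {ε : ℝ}
    (hε : 0 < ε) : ∃ g : C₀(X, ℂ), HasCompactSupport g ∧ ‖f - g‖ < ε := by
  have hev : ∀ᶠ x in cocompact X, ‖f x‖ < ε / 4 := by
    have := (zero_at_infty f).norm
    rw [norm_zero] at this
    exact this.eventually (gt_mem_nhds (by positivity))
  obtain ⟨K, hK, hfK⟩ := mem_cocompact.1 hev
  obtain ⟨F, -, hF1⟩ := hφ.exists_finset K hK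
  set h : C₀(X, ℂ) := ∑ i ∈ F, φ i * φ i with hh
  have hhx : ∀ x, h x = ∑ i ∈ F, φ i x * φ i x := fun x =>
    ZeroAtInftyContinuousMap.sum_apply F _ x
  refine ⟨f * h, ?_, ?_⟩
  · refine HasCompactSupport.mul_left (f' := ⇑h) ?_
    refine HasCompactSupport.intro (F.isCompact_biUnion fun i _ => hφ.hasCompactSupport i)
      fun x hx => ?_
    rw [hhx]
    refine Finset.sum_eq_zero fun i hi => ?_
    rw [image_eq_zero_of_notMem_tsupport fun hxi => hx (Set.mem_biUnion hi hxi), mul_zero]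
  · refine (ZeroAtInftyContinuousMap.norm_le_of_forall (c := ε / 2) (by positivity)
      fun x => ?_).trans_lt (by linarith)
    have hfac : (f - f * h) x = f x * (1 - h x) := by
      rw [ZeroAtInftyContinuousMap.sub_apply, ZeroAtInftyContinuousMap.mul_apply]; ring
    rw [hfac]
    by_cases hx : x ∈ K
    · rw [hhx, hF1 x hx, sub_self, mul_zero, norm_zero]; positivity
    · have h1 : ‖f x‖ < ε / 4 := hfK hx
      have h2 : ‖1 - h x‖ ≤ 2 := by
        refine (norm_sub_le _ _).trans ?_
        have := (ZeroAtInftyContinuousMap.norm_apply_le_norm h x).trans (hφ.norm_sum_le F)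
        rw [norm_one]; linarith
      rw [norm_mul]
      nlinarith [norm_nonneg (f x), norm_nonneg (1 - h x)]

/-- Local compactness may be tested on compactly supported functions. -/
theorem isLocCompactOp_of_hasCompactSupport (hφ : IsSquarePartition φ) {C : H →L[ℂ] H}
    (hC : ∀ f : C₀(X, ℂ), HasCompactSupport f →
      IsCompactOperator (ρ f * C) ∧ IsCompactOperator (C * ρ f)) :
    IsLocCompactOp ρ C := by
  intro f
  have hn : ∀ n : ℕ, ∃ g : C₀(X, ℂ), HasCompactSupport g ∧ ‖f - g‖ < 1 / (n + 1) :=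
    fun n => hφ.exists_hasCompactSupport_norm_sub_lt f (by positivity)
  choose g hg hfg using hn
  have hlim : Tendsto (fun n => ρ (g n)) atTop (nhds (ρ f)) := by
    rw [tendsto_iff_norm_sub_tendsto_zero]
    refine squeeze_zero (fun _ => norm_nonneg _) (fun n => ?_)
      tendsto_one_div_add_atTop_nhds_zero_nat
    rw [← map_sub]
    refine (NonUnitalStarAlgHom.norm_apply_le ρ _).trans ?_
    rw [norm_sub_rev]
    exact (hfg n).le
  exact ⟨isCompactOperator_of_tendsto (hlim.mul_const C)
      (Filter.Eventually.of_forall fun n => (hC _ (hg n)).1),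
    isCompactOperator_of_tendsto (hlim.const_mul C)
      (Filter.Eventually.of_forall fun n => (hC _ (hg n)).2)⟩

/-- A compactly supported function only meets finitely many members of the partition. -/
theorem exists_finset_mul_eq (hφ : IsSquarePartition φ) {f : C₀(X, ℂ)}
    (hf : HasCompactSupport f) : ∃ F : Finset ι, (∀ i ∉ F, f * φ i = 0) ∧
      ∑ i ∈ F, f * φ i * φ i = f := by
  obtain ⟨F, hF0, hF1⟩ := hφ.exists_finset _ hf
  refine ⟨F, fun i hi => ?_, ?_⟩
  · ext x
    rw [ZeroAtInftyContinuousMap.mul_apply, ZeroAtInftyContinuousMap.zero_apply]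
    by_cases hx : x ∈ tsupport f
    · rw [hF0 i hi x hx, mul_zero]
    · rw [image_eq_zero_of_notMem_tsupport hx, zero_mul]
  · ext x
    rw [ZeroAtInftyContinuousMap.sum_apply]
    simp only [ZeroAtInftyContinuousMap.mul_apply, mul_assoc]
    rw [← Finset.mul_sum]
    by_cases hx : x ∈ tsupport f
    · rw [hF1 x hx, mul_one]
    · rw [image_eq_zero_of_notMem_tsupport hx, zero_mul]

/-- `T - ∑ φᵢ T φᵢ` is locally compact when `T` is pseudolocal. -/
theorem isLocCompactOp_sub (hφ : IsSquarePartition φ) {T S : H →L[ℂ] H}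
    (hT : IsPseudolocalOp ρ T)
    (hS : ∀ v, HasSum (fun i => ρ (φ i) (T (ρ (φ i) v))) (S v)) :
    IsLocCompactOp ρ (T - S) := by
  refine hφ.isLocCompactOp_of_hasCompactSupport ρ fun f hf => ?_
  obtain ⟨F, hF0, hF1⟩ := hφ.exists_finset_mul_eq hf
  have hcomm : ∀ i, ρ f * ρ (φ i) = ρ (φ i) * ρ f := fun i => by
    rw [← map_mul, ← map_mul, mul_comm]
  have hz : ∀ i ∉ F, ρ f * ρ (φ i) = 0 := fun i hi => by rw [← map_mul, hF0 i hi, map_zero]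
  have hρf : ρ f = ∑ i ∈ F, ρ f * ρ (φ i) * ρ (φ i) := by
    conv_lhs => rw [← hF1]
    simp only [map_sum, map_mul]
  have hleft : ρ f * S = ∑ i ∈ F, ρ f * ρ (φ i) * (T * ρ (φ i)) := by
    ext v
    refine ((hS v).mapL (ρ f)).unique ?_
    rw [_root_.sum_apply]
    refine hasSum_sum_of_ne_finset_zero fun i hi => ?_
    exact congrArg (fun A : H →L[ℂ] H => A (T (ρ (φ i) v))) (hz i hi)
  have hright : S * ρ f = ∑ i ∈ F, ρ (φ i) * T * (ρ (φ i) * ρ f) := by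
    ext v
    refine (hS (ρ f v)).unique ?_
    rw [_root_.sum_apply]
    refine hasSum_sum_of_ne_finset_zero fun i hi => ?_
    have h : ρ (φ i) (ρ f v) = 0 :=
      congrArg (fun A : H →L[ℂ] H => A v) ((hcomm i).symm.trans (hz i hi))
    simp only [h, map_zero]
  have hsum : ∀ A : ι → H →L[ℂ] H, (∀ i, IsCompactOperator (A i)) →
      IsCompactOperator (∑ i ∈ F, A i : H →L[ℂ] H) := fun A hA =>
    Finset.sum_induction A (fun B : H →L[ℂ] H => IsCompactOperator B) (fun _ _ => .add)
      isCompactOperator_zero fun i _ => hA i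
  constructor
  · have h : ρ f * (T - S) = ∑ i ∈ F, (ρ f * ρ (φ i)) * (ρ (φ i) * T - T * ρ (φ i)) := by
      rw [mul_sub, hleft]
      conv_lhs => enter [1]; rw [hρf]
      simp only [Finset.sum_mul, mul_assoc, mul_sub, Finset.sum_sub_distrib]
    rw [h]
    exact hsum _ fun i => (hT (φ i)).clm_comp (ρ f * ρ (φ i))
  · have h : (T - S) * ρ f =
        -∑ i ∈ F, (ρ (φ i) * T - T * ρ (φ i)) * (ρ (φ i) * ρ f) := by
      simp only [sub_mul, Finset.sum_sub_distrib, hright, neg_sub]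
      congr 1
      conv_lhs => rw [hρf]
      rw [Finset.mul_sum]
      refine Finset.sum_congr rfl fun i _ => ?_
      rw [mul_assoc T, hcomm i, mul_assoc, hcomm i]
    rw [h]
    exact (hsum _ fun i => (hT (φ i)).comp_clm (ρ (φ i) * ρ f)).neg

end IsSquarePartition

/-- If `φ z` vanishes at distance at least `R` from `z`, then `∑ φ_z T φ_z` has finite
propagation. -/
theorem hasPropLE_of_hasSum (ρ : C₀(X, ℂ) →⋆ₙₐ[ℂ] (H →L[ℂ] H)) {φ : X → C₀(X, ℂ)} {R : ℝ}
    (hR : ∀ z x, R ≤ dist x z → φ z x = 0) {T S : H →L[ℂ] H}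
    (hS : ∀ v, HasSum (fun z => ρ (φ z) (T (ρ (φ z) v))) (S v)) :
    HasPropLE ρ S (2 * R) := by
  intro f g hfg
  have hterm : ∀ z, f * φ z = 0 ∨ φ z * g = 0 := by
    intro z
    by_contra! h
    obtain ⟨x, hx⟩ := DFunLike.ne_iff.1 h.1
    obtain ⟨y, hy⟩ := DFunLike.ne_iff.1 h.2
    rw [ZeroAtInftyContinuousMap.mul_apply] at hx hy
    have hxz : dist x z < R := by
      by_contra! h'; exact right_ne_zero_of_mul hx (hR z x h')
    have hyz : dist y z < R := by
      by_contra! h'; exact left_ne_zero_of_mul hy (hR z y h')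
    have := hfg x (subset_closure (left_ne_zero_of_mul hx)) y
      (subset_closure (right_ne_zero_of_mul hy))
    linarith [dist_triangle_right x y z]
  ext v
  refine ((hS (ρ g v)).mapL (ρ f)).unique ?_
  rw [_root_.zero_apply]
  convert hasSum_zero with z
  rcases hterm z with h | h
  · have h' : ρ f * ρ (φ z) = 0 := by rw [← map_mul, h, map_zero]
    exact congrArg (fun A : H →L[ℂ] H => A (T (ρ (φ z) (ρ g v)))) h'
  · have h' : ρ (φ z) (ρ g v) = 0 := by
      change (ρ (φ z) * ρ g) v = 0
      rw [← map_mul, h, map_zero]; rfl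
    rw [h', map_zero, map_zero, map_zero]

/-- If `φ` is an equivariant family, then `∑ φ_z T φ_z` is invariant for invariant `T`. -/
theorem isEquivariantOp_of_hasSum {ρ : C₀(X, ℂ) →⋆ₙₐ[ℂ] (H →L[ℂ] H)}
    {u : Γ →* unitary (H →L[ℂ] H)} (hcov : CovariantRep ρ u) {φ : X → C₀(X, ℂ)}
    (hφ : ∀ (γ : Γ) (z x : X), φ (γ • z) x = φ z (γ⁻¹ • x)) {T S : H →L[ℂ] H}
    (hT : IsEquivariantOp u T)
    (hS : ∀ v, HasSum (fun z => ρ (φ z) (T (ρ (φ z) v))) (S v)) :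
    IsEquivariantOp u S := by
  intro γ
  have hu : ∀ z, (u γ : H →L[ℂ] H) * ρ (φ z) = ρ (φ (γ • z)) * u γ := by
    intro z
    rw [hcov γ (φ z) (φ (γ • z)) (hφ γ z), mul_assoc, Unitary.coe_star_mul_self, mul_one]
  ext v
  refine ((hS v).mapL (u γ : H →L[ℂ] H)).unique ?_
  have huv : ∀ z w, (u γ : H →L[ℂ] H) (ρ (φ z) w) = ρ (φ (γ • z)) ((u γ : H →L[ℂ] H) w) :=
    fun z w => congrArg (fun A : H →L[ℂ] H => A w) (hu z)
  have hTv : ∀ w, (u γ : H →L[ℂ] H) (T w) = T ((u γ : H →L[ℂ] H) w) :=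
    fun w => congrArg (fun A : H →L[ℂ] H => A w) (hT γ)
  change HasSum (fun z => (u γ : H →L[ℂ] H) (ρ (φ z) (T (ρ (φ z) v))))
    (S ((u γ : H →L[ℂ] H) v))
  simp only [huv, hTv]
  have h := hS ((u γ : H →L[ℂ] H) v)
  rw [← (MulAction.toPerm γ).hasSum_iff] at h
  simpa only [Function.comp_def, MulAction.toPerm_apply] using h

end Compression

/-- Every Γ-invariant pseudolocal operator `T` on `H` is the sum
`T = S + C` of an element `S ∈ 𝕊(X)^Γ` (Γ-invariant, pseudolocal, finite propagation) and
a Γ-invariant locally compact operator `C`; that is,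
`𝔇*(X)^Γ = 𝕊(X)^Γ + ℭ*(X)^Γ`.  The representation `ρ` of `C₀(X)` is assumed very ample. -/
theorem pseudolocal_decomposes_as_finite_propagation_plus_locally_compact
    [ProperSpace X] [TopologicalSpace.SeparableSpace X]
    [ProperlyDiscontinuousSMul Γ X]
    (hiso : ∀ γ : Γ, Isometry fun x : X => γ • x)
    (hfree : ∀ (γ : Γ) (x : X), γ • x = x → γ = 1)
    [TopologicalSpace.SeparableSpace H]
    (ρ : C₀(X, ℂ) →⋆ₙₐ[ℂ] (H →L[ℂ] H)) (u : Γ →* unitary (H →L[ℂ] H))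
    (hnd : NondegRep ρ) (hcov : CovariantRep ρ u)
    -- `ρ` is very ample
    {H₁ : Type} [NormedAddCommGroup H₁] [InnerProductSpace ℂ H₁] [CompleteSpace H₁]
    (ρ₁ : C₀(X, ℂ) →⋆ₙₐ[ℂ] (H₁ →L[ℂ] H₁)) (hample₁ : AmpleRep ρ₁)
    (U : H ≃ₗᵢ[ℂ] lp (fun _ : ℕ => H₁) 2)
    (hU : ∀ (f : C₀(X, ℂ)) (v : H) (n : ℕ), (U (ρ f v)) n = ρ₁ f ((U v) n)) :
    ∀ T : H →L[ℂ] H, IsEquivariantOp u T → IsPseudolocalOp ρ T →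
      ∃ S C : H →L[ℂ] H, S ∈ StructAlgSet ρ u ∧
        IsEquivariantOp u C ∧ IsLocCompactOp ρ C ∧ T = S + C := by
  intro T hTu hT
  obtain ⟨φ, hφ, hfar, hinv⟩ := exists_equivariant_squarePartition hiso
  obtain ⟨S, hS⟩ := hφ.exists_compression ρ T
  have hSu := isEquivariantOp_of_hasSum hcov hinv hTu hS
  have hC := hφ.isLocCompactOp_sub ρ hT hS
  refine ⟨S, T - S, ⟨hSu, fun f => ?_, 2 * 2, by norm_num, hasPropLE_of_hasSum ρ hfar hS⟩,
    fun γ => by rw [mul_sub, sub_mul, hTu, hSu], hC, (add_sub_cancel S T).symm⟩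
  have h : ρ f * S - S * ρ f = (ρ f * T - T * ρ f) - (ρ f * (T - S) - (T - S) * ρ f) := by
    noncomm_ring
  rw [h]
  exact (hT f).sub ((hC f).1.sub (hC f).2)
end
end
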